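/- Let m ≥ 2 and let cl(D(c₁, r₁)), …, cl(D(c_m, r_m)) be pairwise disjoint closed discs contained in the open unit disc D(0,1). Let Ω = D(0,1) \ ( cl(D(c₁, r₁)) ∪ … ∪ cl(D(c_m, r_m)) ). Then the automorphism group of Ω is finite. -/

import Mathlib

/-- The unit disc with the closed discs `cl(D(cᵢ, rᵢ))`, `i = 1, …, m`, removed. -/
def HoledDisc (m : ℕ) (c : Fin m → ℂ) (r : Fin m → ℝ) : Set ℂ :=
  Metric.ball (0:ℂ) 1 \ ⋃ i, Metric.closedBall (c i) (r i)

namespace HoledDiscAut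

open MeasureTheory Set Filter Metric Topology
open scoped ENNReal Real InnerProductSpace

lemma isOpen_annulus (c : ℂ) (a b : ℝ) : IsOpen {z : ℂ | a < ‖z - c‖ ∧ ‖z - c‖ < b} := by
  rw [ofPred_and]
  exact (isOpen_lt (by fun_prop) (by fun_prop)).inter (isOpen_lt (by fun_prop) (by fun_prop))

/-- An injective holomorphic function has nonvanishing derivative. -/
lemma deriv_ne_zero_of_injOn {f : ℂ → ℂ} {U : Set ℂ} (hU : IsOpen U)
    (hf : DifferentiableOn ℂ f U) (hinj : InjOn f U) {a : ℂ} (ha : a ∈ U) : deriv f a ≠ 0 := by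
  intro h0
  have hfa : AnalyticAt ℂ f a := hf.analyticAt (hU.mem_nhds ha)
  have hF : AnalyticAt ℂ (fun z => f z - f a) a := hfa.sub analyticAt_const
  have hne : ¬ ∀ᶠ z in 𝓝 a, f z - f a = 0 := by
    intro h
    have h1 : ∀ᶠ z in 𝓝[≠] a, z ∈ U ∧ f z - f a = 0 ∧ z ≠ a :=
      ((eventually_nhdsWithin_of_eventually_nhds (hU.eventually_mem ha)).and
        ((eventually_nhdsWithin_of_eventually_nhds h).and self_mem_nhdsWithin))
    obtain ⟨z, hz, hz', hza⟩ := h1.exists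
    exact hza (hinj hz ha (sub_eq_zero.1 hz'))
  obtain ⟨n, g, hg, hga, hfg⟩ := hF.exists_eventuallyEq_pow_smul_nonzero_iff.2 hne
  have hn0 : n ≠ 0 := by
    rintro rfl
    have := hfg.self_of_nhds
    simp at this
    exact hga this.symm
  have hn1 : n ≠ 1 := by
    rintro rfl
    have h1 : HasDerivAt (fun z => (z - a) ^ 1 • g z) (g a) a := by
      have := ((hasDerivAt_id a).sub_const a).fun_mul hg.differentiableAt.hasDerivAt
      simpa using this
    have h2 : HasDerivAt (fun z => f z - f a) (deriv f a) a :=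
      hfa.differentiableAt.hasDerivAt.sub_const _
    exact hga ((h1.congr_of_eventuallyEq hfg).unique (h0 ▸ h2))
  have hnC : (n : ℂ) ≠ 0 := by exact_mod_cast hn0
  set h : ℂ → ℂ := fun z => (z - a) * (g z / g a) ^ (1 / n : ℂ) with hh
  have hhd : HasStrictDerivAt h 1 a := by
    have hq : AnalyticAt ℂ (fun z => (g z / g a) ^ (1 / n : ℂ)) a := by
      refine (hg.div analyticAt_const hga).cpow analyticAt_const ?_
      simp [hga]
    have han : AnalyticAt ℂ h a := (analyticAt_id.sub analyticAt_const).mul hq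
    have := ((hasDerivAt_id a).sub_const a).fun_mul hq.differentiableAt.hasDerivAt
    have h2 : HasDerivAt h 1 a := by simpa [hh, hga] using this
    have h3 := han.hasStrictDerivAt
    rwa [h2.deriv] at h3
  have hmap := hhd.map_nhds_eq one_ne_zero
  have hha : h a = 0 := by simp [hh]
  rw [hha] at hmap
  have hS : {z | z ∈ U ∧ f z - f a = g a * h z ^ n} ∈ 𝓝 a := by
    filter_upwards [hU.mem_nhds ha, hfg] with z hz hz'
    refine ⟨hz, ?_⟩
    rw [hz', hh, mul_pow, one_div, Complex.cpow_nat_inv_pow _ hn0]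
    simp only [smul_eq_mul]
    field_simp
  have him : h '' {z | z ∈ U ∧ f z - f a = g a * h z ^ n} ∈ 𝓝 (0 : ℂ) := by
    rw [← hmap]; exact image_mem_map hS
  set ζ : ℂ := Complex.exp (2 * Real.pi * Complex.I / n)
  have hζ : IsPrimitiveRoot ζ n := Complex.isPrimitiveRoot_exp n hn0
  have h2 : ∀ᶠ w in 𝓝 (0 : ℂ), ζ * w ∈ h '' {z | z ∈ U ∧ f z - f a = g a * h z ^ n} := by
    have : Tendsto (fun w => ζ * w) (𝓝 0) (𝓝 0) := by
      have := (continuous_const_mul ζ).tendsto 0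
      simpa using this
    exact this him
  have h3 : ∀ᶠ w in 𝓝[≠] (0 : ℂ), w ∈ h '' {z | z ∈ U ∧ f z - f a = g a * h z ^ n} ∧
      ζ * w ∈ h '' {z | z ∈ U ∧ f z - f a = g a * h z ^ n} ∧ w ≠ 0 :=
    (eventually_nhdsWithin_of_eventually_nhds him).and
      ((eventually_nhdsWithin_of_eventually_nhds h2).and self_mem_nhdsWithin)
  obtain ⟨w, ⟨z, ⟨hzU, hz⟩, rfl⟩, ⟨z', ⟨hzU', hz'⟩, hw'⟩, hw0⟩ := h3.exists
  have : z = z' := by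
    apply hinj hzU hzU'
    have : f z - f a = f z' - f a := by
      rw [hz, hz', hw', mul_pow ζ, hζ.pow_eq_one, one_mul]
    exact sub_left_injective this
  subst this
  have hζ1 : ζ = 1 := by
    have : (ζ - 1) * h z = 0 := by rw [sub_mul, ← hw', one_mul, sub_self]
    rcases mul_eq_zero.1 this with h | h
    · exact sub_eq_zero.1 h
    · exact absurd h hw0
  exact hn1 (by
    have := hζ.eq_orderOf
    rw [hζ1] at this
    simpa using this)

/-- The inverse of a holomorphic self-bijection of an open set is holomorphic. -/
lemma exists_inverse {φ : ℂ → ℂ} {U : Set ℂ} (hU : IsOpen U)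
    (hf : DifferentiableOn ℂ φ U) (hbij : BijOn φ U U) :
    ∃ ψ : ℂ → ℂ, DifferentiableOn ℂ ψ U ∧ MapsTo ψ U U ∧ (∀ z ∈ U, φ (ψ z) = z) ∧
      ∀ z ∈ U, ψ (φ z) = z := by
  have hinv : InvOn (Function.invFunOn φ U) φ U U := hbij.invOn_invFunOn
  have hmap : MapsTo (Function.invFunOn φ U) U U := hbij.surjOn.mapsTo_invFunOn
  refine ⟨Function.invFunOn φ U, ?_, hmap, hinv.2, hinv.1⟩
  intro w hw
  set ψ := Function.invFunOn φ U
  have ha := hmap hw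
  have hs : HasStrictDerivAt φ (deriv φ (ψ w)) (ψ w) :=
    (hf.analyticAt (hU.mem_nhds ha)).hasStrictDerivAt
  have hne := deriv_ne_zero_of_injOn hU hf hbij.injOn ha
  have hl : ∀ᶠ z in 𝓝 (ψ w), ψ (φ z) = z := by
    filter_upwards [hU.mem_nhds ha] with z hz using hinv.1 hz
  have := hs.to_local_left_inverse hne hl
  rw [hinv.2 hw] at this
  exact this.hasDerivAt.differentiableAt.differentiableWithinAt

lemma det_restrictScalars_toSpanSingleton (w : ℂ) :
    (((ContinuousLinearMap.toSpanSingleton ℂ w).restrictScalars ℝ : ℂ →L[ℝ] ℂ)).det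
      = ‖w‖ ^ 2 := by
  simp [ContinuousLinearMap.det, LinearMap.det_restrictScalars,
    Algebra.norm_complex_eq, Complex.normSq_eq_norm_sq]

lemma setLIntegral_pullback {φ : ℂ → ℂ} {U : Set ℂ} (hU : IsOpen U)
    (hf : DifferentiableOn ℂ φ U) (hinj : InjOn φ U) {A : Set ℂ} (hA : MeasurableSet A)
    (hAU : A ⊆ U) (g : ℂ → ℂ) :
    ∫⁻ z in A, ‖g (φ z) * deriv φ z‖ₑ ^ 2 = ∫⁻ z in φ '' A, ‖g z‖ₑ ^ 2 := by
  rw [lintegral_image_eq_lintegral_abs_det_fderiv_mul volume hA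
    (f' := fun z => ((ContinuousLinearMap.toSpanSingleton ℂ (deriv φ z)).restrictScalars ℝ))
    _ (hinj.mono hAU)]
  · refine setLIntegral_congr_fun hA fun z hz => ?_
    simp only [det_restrictScalars_toSpanSingleton]
    rw [abs_of_nonneg (by positivity), enorm_mul, mul_pow, mul_comm, ENNReal.ofReal_pow (by positivity),
      ofReal_norm]
  · intro z hz
    exact (((hf.differentiableAt (hU.mem_nhds (hAU hz))).hasDerivAt.hasFDerivAt).restrictScalars
      ℝ).hasFDerivWithinAt

lemma setIntegral_pullback {φ : ℂ → ℂ} {U : Set ℂ} (hU : IsOpen U)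
    (hf : DifferentiableOn ℂ φ U) (hbij : BijOn φ U U) (a b : ℂ → ℂ) :
    ∫ z in U, (starRingEnd ℂ) (a (φ z) * deriv φ z) * (b (φ z) * deriv φ z)
      = ∫ z in U, (starRingEnd ℂ) (a z) * b z := by
  conv_rhs => rw [← hbij.image_eq]
  rw [integral_image_eq_integral_abs_det_fderiv_smul volume hU.measurableSet
    (f' := fun z => ((ContinuousLinearMap.toSpanSingleton ℂ (deriv φ z)).restrictScalars ℝ))
    _ hbij.injOn]
  · refine setIntegral_congr_fun hU.measurableSet fun z hz => ?_
    simp only [det_restrictScalars_toSpanSingleton]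
    rw [abs_of_nonneg (by positivity)]
    simp only [map_mul, Complex.real_smul, Complex.ofReal_pow, ← Complex.conj_mul']
    ring
  · intro z hz
    exact (((hf.differentiableAt (hU.mem_nhds hz)).hasDerivAt.hasFDerivAt).restrictScalars
      ℝ).hasFDerivWithinAt

/-- Integral over an annulus of a function whose angular integrals do not depend on the radius. -/
lemma setIntegral_annulus {G : ℂ → ℂ} {c L : ℂ} {a b : ℝ} (ha : 0 ≤ a) (hab : a ≤ b)
    (hG : ContinuousOn G {z | a ≤ ‖z - c‖ ∧ ‖z - c‖ ≤ b})
    (hL : ∀ ρ ∈ Ioo a b, ∫ θ in (0 : ℝ)..2 * π, G (circleMap c ρ θ) = L) :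
    ∫ z in {z | a < ‖z - c‖ ∧ ‖z - c‖ < b}, G z = ((b ^ 2 - a ^ 2) / 2 : ℝ) • L := by
  set A : Set ℂ := {z | a < ‖z - c‖ ∧ ‖z - c‖ < b} with hA
  have hAo : IsOpen A := isOpen_annulus _ _ _
  rw [← integral_indicator hAo.measurableSet, ← integral_add_left_eq_self _ c,
    ← Complex.integral_comp_polarCoord_symm]
  have key : ∀ p ∈ polarCoord.target, p.1 • (A.indicator G (c + Complex.polarCoord.symm p))
      = (Ioo a b ×ˢ univ : Set (ℝ × ℝ)).indicator
        (fun p => p.1 • G (circleMap c p.1 p.2)) p := by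
    rintro ⟨ρ, θ⟩ hp
    have hρ : 0 < ρ := hp.1
    have h1 : c + Complex.polarCoord.symm (ρ, θ) = circleMap c ρ θ := by
      simp [Complex.polarCoord_symm_apply, circleMap, Complex.exp_mul_I]
    have h2 : circleMap c ρ θ ∈ A ↔ ρ ∈ Ioo a b := by
      simp [hA, circleMap, abs_of_pos hρ]
    rw [h1]
    by_cases h : ρ ∈ Ioo a b
    · rw [indicator_of_mem (h2.2 h), indicator_of_mem (by simpa using h)]
    · rw [indicator_of_notMem (fun h' => h (h2.1 h')), indicator_of_notMem (by simpa using h)]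
      simp
  rw [setIntegral_congr_fun polarCoord.open_target.measurableSet key,
    setIntegral_indicator (measurableSet_Ioo.prod MeasurableSet.univ)]
  have hset : polarCoord.target ∩ Ioo a b ×ˢ univ = Ioo a b ×ˢ Ioo (-π) π := by
    ext ⟨ρ, θ⟩
    simp only [polarCoord_target, mem_inter_iff, mem_prod, mem_Ioi, mem_univ, and_true]
    constructor
    · rintro ⟨⟨_, h⟩, h'⟩; exact ⟨h', h⟩
    · rintro ⟨h', h⟩; exact ⟨⟨ha.trans_lt h'.1, h⟩, h'⟩
  rw [hset, Measure.volume_eq_prod, setIntegral_prod]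
  · have h3 : ∀ ρ ∈ Ioo a b, ∫ θ in Ioo (-π) π, ρ • G (circleMap c ρ θ) = ρ • L := by
      intro ρ hρ
      rw [integral_smul, ← integral_Ioc_eq_integral_Ioo,
        ← intervalIntegral.integral_of_le (by linarith [Real.pi_pos])]
      congr 1
      rw [← hL ρ hρ]
      have hper : Function.Periodic (fun θ => G (circleMap c ρ θ)) (2 * π) :=
        (periodic_circleMap c ρ).comp G
      have := hper.intervalIntegral_add_eq (-π) 0
      rw [zero_add] at this
      rw [← this]
      congr 1
      ring
    rw [setIntegral_congr_fun measurableSet_Ioo h3, ← integral_Ioc_eq_integral_Ioo,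
      ← intervalIntegral.integral_of_le hab, intervalIntegral.integral_smul_const, integral_id]
  · have hc : ContinuousOn (fun p : ℝ × ℝ => p.1 • G (circleMap c p.1 p.2))
        (Icc a b ×ˢ Icc (-π) π) := by
      refine continuous_fst.continuousOn.smul (hG.comp (by unfold circleMap; fun_prop) ?_)
      rintro ⟨ρ, θ⟩ ⟨hρ, _⟩
      have h0 : 0 ≤ ρ := ha.trans hρ.1
      simpa [circleMap, abs_of_nonneg h0] using hρ
    refine (hc.integrableOn_compact (isCompact_Icc.prod isCompact_Icc)).mono_set ?_
    exact prod_mono Ioo_subset_Icc_self Ioo_subset_Icc_self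

/-- Area mean value property. -/
lemma setIntegral_ball_of_differentiableOn {f : ℂ → ℂ} {c : ℂ} {b : ℝ} (hb : 0 < b)
    {U : Set ℂ} (hf : DifferentiableOn ℂ f U) (hbU : closedBall c b ⊆ U) :
    ∫ z in ball c b, f z = (π * b ^ 2 : ℝ) • f c := by
  have h1 : ∫ z in {z | 0 < ‖z - c‖ ∧ ‖z - c‖ < b}, f z
      = ((b ^ 2 - 0 ^ 2) / 2 : ℝ) • ((2 * π : ℝ) • f c) := by
    refine setIntegral_annulus le_rfl hb.le ?_ ?_
    · refine hf.continuousOn.mono fun z hz => hbU ?_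
      simpa [dist_eq_norm] using hz.2
    · intro ρ hρ
      have hd : DiffContOnCl ℂ f (ball c |ρ|) := by
        refine DifferentiableOn.diffContOnCl (hf.mono ?_)
        rw [abs_of_pos hρ.1, closure_ball _ hρ.1.ne']
        exact (closedBall_subset_closedBall hρ.2.le).trans hbU
      have := hd.circleAverage
      rw [Real.circleAverage_def] at this
      rw [← this, smul_smul, mul_inv_cancel₀ (by positivity), one_smul]
  have h2 : ball c b =ᵐ[volume] {z | 0 < ‖z - c‖ ∧ ‖z - c‖ < b} := by
    have : {z | 0 < ‖z - c‖ ∧ ‖z - c‖ < b} = ball c b \ {c} := by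
      ext z; simp [dist_eq_norm, sub_eq_zero, and_comm]
    rw [this]
    exact (sdiff_null_ae_eq_self (by simp)).symm
  rw [setIntegral_congr_set h2, h1, smul_smul]
  congr 1
  ring

/-- The circle integral weighted over an annulus. -/
lemma setIntegral_annulus_mul_sub {f : ℂ → ℂ} {c L : ℂ} {a b : ℝ} (ha : 0 ≤ a) (hab : a ≤ b)
    (hf : ContinuousOn f {z | a ≤ ‖z - c‖ ∧ ‖z - c‖ ≤ b})
    (hL : ∀ ρ ∈ Ioo a b, ∮ z in C(c, ρ), f z = L) :
    ∫ z in {z | a < ‖z - c‖ ∧ ‖z - c‖ < b}, (z - c) * f z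
      = ((b ^ 2 - a ^ 2) / 2 : ℝ) • (-Complex.I * L) := by
  refine setIntegral_annulus ha hab ?_ ?_
  · exact (by fun_prop : ContinuousOn (fun z => z - c) _).mul hf
  · intro ρ hρ
    rw [← hL ρ hρ, circleIntegral, ← intervalIntegral.integral_const_mul]
    congr 1
    ext θ
    simp only [deriv_circleMap, smul_eq_mul]
    have : circleMap c ρ θ - c = circleMap 0 ρ θ := by simp [circleMap]
    rw [this]
    linear_combination circleMap 0 ρ θ * f (circleMap c ρ θ) * Complex.I_sq

/-- Point evaluation of holomorphic functions is locally uniformly bounded in `L²`. -/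
lemma exists_norm_le_norm_Lp (U : Set ℂ) {δ : ℝ} (hδ : 0 < δ) :
    ∃ C : ℝ, 0 ≤ C ∧ ∀ (z : ℂ) (h : ℂ → ℂ) (u : Lp ℂ 2 (volume.restrict U)),
      closedBall z δ ⊆ U → DifferentiableOn ℂ h U → u =ᵐ[volume.restrict U] h →
      ‖h z‖ ≤ C * ‖u‖ := by
  refine ⟨(volume.real (ball (0 : ℂ) δ)) ^ (1 / (2 : ℝ≥0∞).toReal) / (π * δ ^ 2),
    by positivity, fun z h u hz hh hu => ?_⟩
  have hsub : ball z δ ⊆ U := ball_subset_closedBall.trans hz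
  have hne : (volume.restrict U) (ball z δ) ≠ ∞ :=
    ((Measure.restrict_apply_le _ _).trans_lt measure_ball_lt_top).ne
  have h1 := L2.inner_indicatorConstLp_one (𝕜 := ℂ) (μ := volume.restrict U)
    (measurableSet_ball (x := z) (ε := δ)) hne u
  have h2 : ∫ w in ball z δ, u w ∂(volume.restrict U) = (π * δ ^ 2 : ℝ) • h z := by
    rw [← setIntegral_ball_of_differentiableOn hδ hh hz, Measure.restrict_restrict measurableSet_ball,
      inter_eq_left.2 hsub]
    exact integral_congr_ae (ae_mono (Measure.restrict_mono hsub le_rfl) hu)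
  have h3 : ‖(indicatorConstLp 2 (measurableSet_ball (x := z) (ε := δ)) hne (1 : ℂ))‖
      ≤ (volume.real (ball (0 : ℂ) δ)) ^ (1 / (2 : ℝ≥0∞).toReal) := by
    refine (norm_indicatorConstLp_le).trans ?_
    rw [norm_one, one_mul]
    have : (volume.restrict U).real (ball z δ) = volume.real (ball (0 : ℂ) δ) := by
      rw [Measure.real, Measure.restrict_apply measurableSet_ball, inter_eq_left.2 hsub,
        Complex.volume_ball, Measure.real, Complex.volume_ball]
    rw [this]
  have h4 := norm_inner_le_norm (𝕜 := ℂ)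
    (indicatorConstLp 2 (measurableSet_ball (x := z) (ε := δ)) hne (1 : ℂ)) u
  rw [h1, h2, norm_smul, Real.norm_of_nonneg (by positivity)] at h4
  rw [div_mul_eq_mul_div, le_div_iff₀ (by positivity), mul_comm]
  exact h4.trans (by gcongr)

/-- An `L²` limit of holomorphic functions is holomorphic. -/
lemma exists_differentiableOn_of_tendsto_Lp {U : Set ℂ} (hU : IsOpen U)
    {u : ℕ → Lp ℂ 2 (volume.restrict U)} {f : Lp ℂ 2 (volume.restrict U)}
    (huf : Tendsto u atTop (𝓝 f)) {h : ℕ → ℂ → ℂ} (hh : ∀ n, DifferentiableOn ℂ (h n) U)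
    (hu : ∀ n, u n =ᵐ[volume.restrict U] h n) :
    ∃ g : ℂ → ℂ, DifferentiableOn ℂ g U ∧ f =ᵐ[volume.restrict U] g := by
  have hbound : ∀ x ∈ U, ∃ δ > 0, ∃ C : ℝ, 0 ≤ C ∧ ∀ z ∈ ball x δ, ∀ n m,
      ‖h n z - h m z‖ ≤ C * ‖u n - u m‖ := by
    intro x hx
    obtain ⟨ε, hε, hεU⟩ := Metric.isOpen_iff.1 hU x hx
    obtain ⟨C, hC, hCb⟩ := exists_norm_le_norm_Lp U (δ := ε / 2) (by positivity)
    refine ⟨ε / 2, by positivity, C, hC, fun z hz n m => ?_⟩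
    refine hCb z (fun z => h n z - h m z) (u n - u m) ?_ ((hh n).sub (hh m)) ?_
    · intro w hw
      refine hεU ?_
      rw [mem_ball] at hz ⊢
      rw [mem_closedBall] at hw
      linarith [dist_triangle w z x]
    · filter_upwards [Lp.coeFn_sub (u n) (u m), hu n, hu m] with w h1 h2 h3
      rw [h1, Pi.sub_apply, h2, h3]
  have hlim : ∀ z ∈ U, ∃ y, Tendsto (fun n => h n z) atTop (𝓝 y) := by
    intro z hz
    obtain ⟨δ, hδ, C, hC, hb⟩ := hbound z hz
    apply cauchySeq_tendsto_of_complete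
    rw [Metric.cauchySeq_iff]
    intro ε hε
    obtain ⟨N, hN⟩ := Metric.cauchySeq_iff.1 huf.cauchySeq (ε / (C + 1)) (by positivity)
    refine ⟨N, fun n hn m hm => ?_⟩
    have h1 := hN n hn m hm
    rw [dist_eq_norm, lt_div_iff₀ (by positivity)] at h1
    rw [dist_eq_norm]
    refine (hb z (mem_ball_self hδ) n m).trans_lt ?_
    nlinarith [norm_nonneg (u n - u m)]
  choose! g hg using hlim
  have hunif : TendstoLocallyUniformlyOn h g atTop U := by
    rw [Metric.tendstoLocallyUniformlyOn_iff]
    intro ε hε x hx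
    obtain ⟨δ, hδ, C, hC, hb⟩ := hbound x hx
    refine ⟨ball x δ ∩ U, inter_mem (mem_nhdsWithin_of_mem_nhds (ball_mem_nhds x hδ))
      self_mem_nhdsWithin, ?_⟩
    have h1 : ∀ᶠ n in atTop, C * ‖u n - f‖ < ε := by
      have : Tendsto (fun n => C * ‖u n - f‖) atTop (𝓝 (C * 0)) :=
        (tendsto_iff_norm_sub_tendsto_zero.1 huf).const_mul C
      rw [mul_zero] at this
      exact this.eventually_lt_const hε
    filter_upwards [h1] with n hn z hz
    refine lt_of_le_of_lt ?_ hn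
    have h2 : Tendsto (fun m => ‖h n z - h m z‖) atTop (𝓝 ‖h n z - g z‖) :=
      ((hg z hz.2).const_sub _).norm
    have h3 : Tendsto (fun m => C * ‖u n - u m‖) atTop (𝓝 (C * ‖u n - f‖)) :=
      ((huf.const_sub _).norm).const_mul C
    rw [dist_comm, dist_eq_norm]
    exact le_of_tendsto_of_tendsto' h2 h3 fun m => hb z hz.1 n m
  refine ⟨g, hunif.differentiableOn (Eventually.of_forall hh) hU, ?_⟩
  obtain ⟨ns, hns, hae⟩ := (tendstoInMeasure_of_tendsto_Lp huf).exists_seq_tendsto_ae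
  filter_upwards [hae, ae_all_iff.2 hu, ae_restrict_mem hU.measurableSet] with z h1 h2 h3
  refine tendsto_nhds_unique h1 ?_
  simp_rw [h2]
  exact (hg z h3).comp hns.tendsto_atTop

/-- The weighted annular integral is given by an inner product. -/
lemma exists_inner_eq_setIntegral_annulus {U : Set ℂ} (c : ℂ) (a b : ℝ)
    (hAU : {z | a < ‖z - c‖ ∧ ‖z - c‖ < b} ⊆ U) :
    ∃ k : Lp ℂ 2 (volume.restrict U), ∀ (u : Lp ℂ 2 (volume.restrict U)) (h : ℂ → ℂ),
      u =ᵐ[volume.restrict U] h →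
      ⟪k, u⟫_ℂ = ∫ z in {z | a < ‖z - c‖ ∧ ‖z - c‖ < b}, (z - c) * h z := by
  set A : Set ℂ := {z | a < ‖z - c‖ ∧ ‖z - c‖ < b} with hA
  have hAo : IsOpen A := isOpen_annulus _ _ _
  have hAb : A ⊆ ball c b := fun z hz => by simpa [dist_eq_norm] using hz.2
  set k₀ : ℂ → ℂ := A.indicator fun z => (starRingEnd ℂ) (z - c) with hk₀
  have hmem : MemLp k₀ 2 (volume.restrict U) := by
    rw [hk₀, memLp_indicator_iff_restrict hAo.measurableSet,
      Measure.restrict_restrict hAo.measurableSet, inter_eq_left.2 hAU]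
    have : IsFiniteMeasure (volume.restrict A) :=
      ⟨by simpa using (measure_mono hAb).trans_lt measure_ball_lt_top⟩
    refine MemLp.of_bound (C := b) ?_ ?_
    · exact (by fun_prop : Continuous fun z : ℂ => (starRingEnd ℂ) (z - c)).aestronglyMeasurable
    · filter_upwards [ae_restrict_mem hAo.measurableSet] with z hz
      rw [RCLike.norm_conj]
      exact hz.2.le
  refine ⟨hmem.toLp k₀, fun u h huh => ?_⟩
  rw [L2.inner_def]
  have h1 : (fun z => ⟪(hmem.toLp k₀ : ℂ → ℂ) z, u z⟫_ℂ) =ᵐ[volume.restrict U]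
      A.indicator fun z => (z - c) * h z := by
    filter_upwards [hmem.coeFn_toLp, huh] with z h1 h2
    rw [h1, h2, hk₀]
    by_cases hz : z ∈ A
    · simp [hz, mul_comm]
    · simp [hz]
  rw [integral_congr_ae h1, integral_indicator hAo.measurableSet,
    Measure.restrict_restrict hAo.measurableSet, inter_eq_left.2 hAU]

lemma one_sub_div_mem_slitPlane {u v : ℂ} (h : ‖u‖ < ‖v‖) : 1 - u / v ∈ Complex.slitPlane := by
  have hv : 0 < ‖v‖ := (norm_nonneg _).trans_lt h
  have h1 : ‖u / v‖ < 1 := by rw [norm_div, div_lt_one hv]; exact h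
  left
  have := (Complex.abs_re_le_norm (u / v)).trans_lt h1
  rw [abs_lt] at this
  simp only [Complex.sub_re, Complex.one_re]
  linarith [this.2]

lemma hasDerivAt_circleIntegral_log {f : ℂ → ℂ} {c z₀ : ℂ} {ρ : ℝ} (hρ : 0 < ρ)
    (hf : ContinuousOn f (sphere c ρ)) (hz₀ : ρ < ‖z₀ - c‖) :
    HasDerivAt (fun z => ∮ w in C(c, ρ), f w * Complex.log (1 - (w - c) / (z - c)))
      (∮ w in C(c, ρ), f w * ((w - c) / ((z₀ - c) * (z₀ - w)))) z₀ := by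
  obtain ⟨M, hM⟩ := (isCompact_sphere c ρ).exists_bound_of_continuousOn hf
  set ε := (‖z₀ - c‖ - ρ) / 2 with hε
  have hε0 : 0 < ε := by rw [hε]; linarith
  have hfc : Continuous fun θ => f (circleMap c ρ θ) :=
    hf.comp_continuous (continuous_circleMap c ρ) fun θ => circleMap_mem_sphere c hρ.le θ
  have hwn : ∀ θ, ‖circleMap c ρ θ - c‖ = ρ := fun θ => by simp [circleMap, abs_of_pos hρ]
  have hne : ∀ z : ℂ, ρ < ‖z - c‖ → z - c ≠ 0 ∧ ∀ θ, z - circleMap c ρ θ ≠ 0 := by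
    intro z hz
    refine ⟨norm_pos_iff.1 (hρ.trans hz), fun θ h => ?_⟩
    rw [sub_eq_zero.1 h, hwn] at hz
    exact lt_irrefl _ hz
  have hF : ∀ z : ℂ, ρ < ‖z - c‖ → Continuous fun θ => deriv (circleMap c ρ) θ •
      (f (circleMap c ρ θ) * Complex.log (1 - (circleMap c ρ θ - c) / (z - c))) := by
    intro z hz
    have h1 : Continuous fun θ => Complex.log (1 - (circleMap c ρ θ - c) / (z - c)) :=
      Continuous.clog (by have := continuous_circleMap c ρ; fun_prop)
        fun θ => one_sub_div_mem_slitPlane (by rw [hwn]; exact hz)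
    simp only [deriv_circleMap]
    exact ((continuous_circleMap 0 ρ).mul continuous_const).smul (hfc.mul h1)
  have hF' : ∀ z : ℂ, ρ < ‖z - c‖ → Continuous fun θ => deriv (circleMap c ρ) θ •
      (f (circleMap c ρ θ) *
        ((circleMap c ρ θ - c) / ((z - c) * (z - circleMap c ρ θ)))) := by
    intro z hz
    have h1 : Continuous fun θ =>
        (circleMap c ρ θ - c) / ((z - c) * (z - circleMap c ρ θ)) := by
      have := continuous_circleMap c ρ
      exact Continuous.div (by fun_prop) (by fun_prop)
        fun θ => mul_ne_zero (hne z hz).1 ((hne z hz).2 θ)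
    simp only [deriv_circleMap]
    exact ((continuous_circleMap 0 ρ).mul continuous_const).smul (hfc.mul h1)
  have hopen : ∀ t : ℝ, IsOpen {z : ℂ | t < ‖z - c‖} := fun t =>
    isOpen_lt (by fun_prop) (by fun_prop)
  refine (intervalIntegral.hasDerivAt_integral_of_dominated_loc_of_deriv_le
    (s := {z | ρ + ε < ‖z - c‖}) (bound := fun _ => ρ * (M * (ρ / (ρ * ε))))
    (F' := fun z θ => deriv (circleMap c ρ) θ • (f (circleMap c ρ θ) *
      ((circleMap c ρ θ - c) / ((z - c) * (z - circleMap c ρ θ))))) ?_ ?_ ?_ ?_ ?_ ?_ ?_).2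
  · exact (hopen _).mem_nhds (by rw [mem_ofPred_eq, hε]; linarith)
  · filter_upwards [(hopen ρ).mem_nhds hz₀] with z hz using (hF z hz).aestronglyMeasurable
  · exact (hF z₀ hz₀).intervalIntegrable _ _
  · exact (hF' z₀ hz₀).aestronglyMeasurable
  · refine Eventually.of_forall fun θ _ z hz => ?_
    have hz' : ρ + ε < ‖z - c‖ := hz
    have h1 : ε ≤ ‖z - circleMap c ρ θ‖ := by
      have := norm_sub_norm_le (z - c) (circleMap c ρ θ - c)
      rw [hwn, sub_sub_sub_cancel_right] at this
      linarith
    have h2 : ‖f (circleMap c ρ θ)‖ ≤ M := hM _ (circleMap_mem_sphere c hρ.le θ)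
    have h3 : ‖deriv (circleMap c ρ) θ‖ = ρ := by simp [deriv_circleMap, abs_of_pos hρ]
    rw [norm_smul, norm_mul, norm_div, norm_mul, hwn, h3]
    gcongr
    · exact (norm_nonneg _).trans h2
    · linarith
  · exact intervalIntegrable_const
  · refine Eventually.of_forall fun θ _ z hz => ?_
    have hz' : ρ < ‖z - c‖ := by
      have : ρ + ε < ‖z - c‖ := hz
      linarith
    obtain ⟨h1, h2⟩ := hne z hz'
    have h3 := one_sub_div_mem_slitPlane (u := circleMap c ρ θ - c) (v := z - c)
      (by rw [hwn]; exact hz')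
    have h4 : HasDerivAt (fun z => 1 - (circleMap c ρ θ - c) / (z - c))
        ((circleMap c ρ θ - c) / (z - c) ^ 2) z := by
      have := ((hasDerivAt_const z (circleMap c ρ θ - c)).fun_div
        ((hasDerivAt_id z).sub_const c) h1).const_sub 1
      refine this.congr_deriv ?_
      simp [neg_div]
    refine (((h4.clog h3).const_mul (f (circleMap c ρ θ))).const_smul
      (deriv (circleMap c ρ) θ)).congr_deriv ?_
    have h5 : 1 - (circleMap c ρ θ - c) / (z - c) = (z - circleMap c ρ θ) / (z - c) := by
      field_simp; ring
    rw [h5]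
    have := h2 θ
    congr 2
    field_simp

lemma circleIntegral_eq_of_annulus {f : ℂ → ℂ} {c : ℂ} {r R a b : ℝ} (hr : 0 < r)
    (hf : DifferentiableOn ℂ f {z | r < ‖z - c‖ ∧ ‖z - c‖ < R}) (ha : a ∈ Ioo r R)
    (hb : b ∈ Ioo r R) : ∮ z in C(c, a), f z = ∮ z in C(c, b), f z := by
  wlog hab : a ≤ b generalizing a b
  · exact (this hb ha (le_of_not_ge hab)).symm
  have hA : IsOpen {z : ℂ | r < ‖z - c‖ ∧ ‖z - c‖ < R} := isOpen_annulus _ _ _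
  have hsub : ∀ z ∈ closedBall c b \ ball c a, z ∈ {z | r < ‖z - c‖ ∧ ‖z - c‖ < R} := by
    rintro z ⟨hz, hz'⟩
    rw [mem_closedBall, dist_eq_norm] at hz
    rw [mem_ball, dist_eq_norm, not_lt] at hz'
    exact ⟨ha.1.trans_le hz', hz.trans_lt hb.2⟩
  refine (Complex.circleIntegral_eq_of_differentiable_on_annulus_off_countable (hr.trans ha.1) hab
    countable_empty (hf.continuousOn.mono hsub) ?_).symm
  rintro z ⟨⟨hz, hz'⟩, -⟩
  refine hf.differentiableAt (hA.mem_nhds (hsub z ⟨ball_subset_closedBall hz, fun h => hz' ?_⟩))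
  exact ball_subset_closedBall h

/-- Cauchy's formula on an annulus. -/
lemma circleIntegral_sub_circleIntegral {f : ℂ → ℂ} {c z : ℂ} {r R a b : ℝ} (hr : 0 < r)
    (hf : DifferentiableOn ℂ f {z | r < ‖z - c‖ ∧ ‖z - c‖ < R}) (ha : r < a) (hb : b < R)
    (haz : a < ‖z - c‖) (hzb : ‖z - c‖ < b) :
    (∮ w in C(c, b), (w - z)⁻¹ * f w) - ∮ w in C(c, a), (w - z)⁻¹ * f w
      = 2 * π * Complex.I * f z := by
  have ha0 : 0 < a := hr.trans ha
  have hb0 : 0 < b := ha0.trans (haz.trans hzb)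
  have hA : IsOpen {z : ℂ | r < ‖z - c‖ ∧ ‖z - c‖ < R} := isOpen_annulus _ _ _
  have hz : z ∈ {z : ℂ | r < ‖z - c‖ ∧ ‖z - c‖ < R} := ⟨ha.trans haz, hzb.trans hb⟩
  have hg := (Complex.differentiableOn_dslope (hA.mem_nhds hz)).2 hf
  have hI := circleIntegral_eq_of_annulus hr hg (a := a) (b := b)
    ⟨ha, (haz.trans hzb).trans hb⟩ ⟨ha.trans (haz.trans hzb), hb⟩
  have key : ∀ ρ, r < ρ → ρ < R → ρ ≠ ‖z - c‖ → ∮ w in C(c, ρ), dslope f z w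
      = (∮ w in C(c, ρ), (w - z)⁻¹ * f w) - (∮ w in C(c, ρ), (w - z)⁻¹) * f z := by
    intro ρ h1 h2 h3
    have hρ : 0 < ρ := hr.trans h1
    have hns : ∀ w ∈ sphere c ρ, w - z ≠ 0 := by
      intro w hw h
      rw [sub_eq_zero.1 h, mem_sphere, dist_eq_norm] at hw
      exact h3 hw.symm
    have hinv : ContinuousOn (fun w => (w - z)⁻¹) (sphere c ρ) :=
      ContinuousOn.inv₀ (by fun_prop) hns
    have hfc : ContinuousOn f (sphere c ρ) := by
      refine hf.continuousOn.mono fun w hw => ?_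
      rw [mem_sphere, dist_eq_norm] at hw
      exact ⟨by rw [hw]; exact h1, by rw [hw]; exact h2⟩
    have e1 : ∮ w in C(c, ρ), dslope f z w
        = ∮ w in C(c, ρ), ((w - z)⁻¹ * f w - f z * (w - z)⁻¹) := by
      refine circleIntegral.integral_congr hρ.le fun w hw => ?_
      have hwz : w ≠ z := fun h => hns w hw (sub_eq_zero.2 h)
      simp only [dslope_of_ne _ hwz, slope_def_module, smul_eq_mul]
      ring
    rw [e1, circleIntegral.integral_sub, circleIntegral.integral_const_mul, mul_comm (f z)]
    · exact (hinv.mul hfc).circleIntegrable hρ.le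
    · exact (continuousOn_const.mul hinv).circleIntegrable hρ.le
  rw [key a ha ((haz.trans hzb).trans hb) haz.ne,
    key b (ha.trans (haz.trans hzb)) hb hzb.ne',
    circleIntegral.integral_sub_inv_of_mem_ball (c := c) (w := z) (R := b)
      (by simpa [dist_eq_norm] using hzb)] at hI
  have h0 : ∮ w in C(c, a), (w - z)⁻¹ = 0 := by
    refine DiffContOnCl.circleIntegral_eq_zero ha0.le ?_
    refine DifferentiableOn.diffContOnCl ?_
    rw [closure_ball _ ha0.ne']
    refine DifferentiableOn.inv (by fun_prop) fun w hw h => ?_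
    rw [sub_eq_zero.1 h, mem_closedBall, dist_eq_norm] at hw
    exact absurd hw (not_le.2 haz)
  rw [h0, zero_mul, sub_zero] at hI
  linear_combination -hI

lemma exists_hasDerivAt_laurent {f : ℂ → ℂ} {c : ℂ} {r R : ℝ} (hr : 0 < r)
    (hf : DifferentiableOn ℂ f {z | r < ‖z - c‖ ∧ ‖z - c‖ < R}) :
    ∃ P : ℂ → ℂ, ∀ z, r < ‖z - c‖ → ∀ ρ, r < ρ → ρ < ‖z - c‖ → ρ < R →
      HasDerivAt P (∮ w in C(c, ρ), f w * ((w - c) / ((z - c) * (z - w)))) z := by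
  let L : ℝ → ℂ → ℂ := fun ρ z => ∮ w in C(c, ρ), f w * Complex.log (1 - (w - c) / (z - c))
  have hL : ∀ z a b, r < a → a < ‖z - c‖ → a < R → r < b → b < ‖z - c‖ → b < R →
      L a z = L b z := by
    intro z a b ha haz haR hb hbz hbR
    refine circleIntegral_eq_of_annulus (R := min ‖z - c‖ R) hr (DifferentiableOn.mul ?_ ?_)
      ⟨ha, lt_min haz haR⟩ ⟨hb, lt_min hbz hbR⟩
    · exact hf.mono fun w hw => ⟨hw.1, hw.2.trans_le (min_le_right _ _)⟩
    · exact DifferentiableOn.clog (by fun_prop)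
        fun w hw => one_sub_div_mem_slitPlane (hw.2.trans_le (min_le_left _ _))
  refine ⟨fun z => L ((r + min ‖z - c‖ R) / 2) z, fun z₀ hz₀ ρ hρ hρz hρR => ?_⟩
  have hfc : ContinuousOn f (sphere c ρ) := by
    refine hf.continuousOn.mono fun w hw => ?_
    rw [mem_sphere, dist_eq_norm] at hw
    exact ⟨by rw [hw]; exact hρ, by rw [hw]; exact hρR⟩
  refine (hasDerivAt_circleIntegral_log (hr.trans hρ) hfc hρz).congr_of_eventuallyEq ?_
  have hopen : IsOpen {z : ℂ | ρ < ‖z - c‖} := isOpen_lt (by fun_prop) (by fun_prop)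
  filter_upwards [hopen.mem_nhds hρz] with z hz
  have hz' : ρ < ‖z - c‖ := hz
  have h1 : r < min ‖z - c‖ R := lt_min (hρ.trans hz') (hρ.trans hρR)
  have h2 := min_le_left ‖z - c‖ R
  have h3 := min_le_right ‖z - c‖ R
  exact hL z _ _ (by linarith) (by linarith) (by linarith) hρ hz' hρR

/-- Laurent decomposition on an annulus, the principal part being given as a residue term plus
the derivative of a function holomorphic outside the inner disc. -/
lemma exists_laurent {f : ℂ → ℂ} {c : ℂ} {r R : ℝ} (hr : 0 < r) (hrR : r < R)
    (hf : DifferentiableOn ℂ f {z | r < ‖z - c‖ ∧ ‖z - c‖ < R}) :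
    ∃ R' ∈ Ioo r R, ∃ (p P : ℂ → ℂ) (a : ℂ), DifferentiableOn ℂ p (ball c R') ∧
      DifferentiableOn ℂ P {z | r < ‖z - c‖} ∧
      ∀ z, r < ‖z - c‖ → ‖z - c‖ < R' → f z = p z + a / (z - c) + deriv P z := by
  obtain ⟨P, hP⟩ := exists_hasDerivAt_laurent hr hf
  obtain ⟨R', h1, h2⟩ := exists_between hrR
  have hR' : 0 < R' := hr.trans h1
  have hfs : ∀ ρ, r < ρ → ρ < R → ContinuousOn f (sphere c ρ) := by
    intro ρ hρ hρR
    refine hf.continuousOn.mono fun w hw => ?_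
    rw [mem_sphere, dist_eq_norm] at hw
    exact ⟨by rw [hw]; exact hρ, by rw [hw]; exact hρR⟩
  refine ⟨R', ⟨h1, h2⟩, fun z => (2 * π * Complex.I : ℂ)⁻¹ • ∮ w in C(c, R'), (w - z)⁻¹ • f w,
    fun z => (2 * π * Complex.I : ℂ)⁻¹ * P z,
    (2 * π * Complex.I : ℂ)⁻¹ * ∮ w in C(c, R'), f w, ?_, ?_, ?_⟩
  · have hci : CircleIntegrable f c R' := (hfs R' h1 h2).circleIntegrable hR'.le
    lift R' to NNReal using hR'.le
    refine (hasFPowerSeriesOn_cauchy_integral hci hR').differentiableOn.mono fun w hw => ?_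
    rw [mem_eball, edist_lt_coe]
    exact hw
  · intro z hz
    obtain ⟨ρ, h3, h4⟩ := exists_between (lt_min (show r < ‖z - c‖ from hz) hrR)
    exact ((hP z hz ρ h3 (h4.trans_le (min_le_left _ _))
      (h4.trans_le (min_le_right _ _))).const_mul _).differentiableAt.differentiableWithinAt
  · intro z hz hzR
    obtain ⟨ρ, h3, h4⟩ := exists_between hz
    have hρR : ρ < R := (h4.trans hzR).trans h2
    have hρ0 : 0 < ρ := hr.trans h3
    have hC := circleIntegral_sub_circleIntegral hr hf h3 h2 h4 hzR
    have hD := ((hP z hz ρ h3 h4 hρR).const_mul ((2 * π * Complex.I : ℂ)⁻¹)).deriv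
    have hz0 : z - c ≠ 0 := norm_pos_iff.1 (hr.trans hz)
    have hns : ∀ w ∈ sphere c ρ, z - w ≠ 0 := by
      intro w hw h
      rw [← sub_eq_zero.1 h, mem_sphere, dist_eq_norm] at hw
      exact h4.ne' hw
    have hE : ∮ w in C(c, ρ), (w - z)⁻¹ * f w = - ((∮ w in C(c, R'), f w) / (z - c)) -
        ∮ w in C(c, ρ), f w * ((w - c) / ((z - c) * (z - w))) := by
      rw [circleIntegral_eq_of_annulus hr hf ⟨h1, h2⟩ ⟨h3, hρR⟩, div_eq_mul_inv, mul_comm,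
        ← circleIntegral.integral_const_mul, ← neg_one_mul, ← circleIntegral.integral_const_mul,
        ← circleIntegral.integral_sub]
      · refine circleIntegral.integral_congr hρ0.le fun w hw => ?_
        have h5 := hns w hw
        have h6 : w - z ≠ 0 := fun h => h5 (by rw [← neg_sub, h, neg_zero])
        rw [← neg_sub z w, inv_neg]
        field_simp
        ring
      · exact (continuousOn_const.mul (continuousOn_const.mul (hfs ρ h3 hρR))).circleIntegrable
          hρ0.le
      · refine ((hfs ρ h3 hρR).mul (ContinuousOn.div (by fun_prop) (by fun_prop) ?_)).circleIntegrable
          hρ0.le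
        exact fun w hw => mul_ne_zero hz0 (hns w hw)
    have hpi : (2 * π * Complex.I : ℂ) ≠ 0 := Complex.two_pi_I_ne_zero
    rw [hD]
    rw [hE] at hC
    have hC' : f z = (2 * π * Complex.I : ℂ)⁻¹ * (2 * π * Complex.I * f z) := by
      rw [inv_mul_cancel_left₀ hpi]
    rw [hC', ← hC]
    simp only [smul_eq_mul]
    ring

lemma isOpen_holedDisc (m : ℕ) (c : Fin m → ℂ) (r : Fin m → ℝ) : IsOpen (HoledDisc m c r) :=
  isOpen_ball.sdiff (isClosed_iUnion_of_finite fun _ => isClosed_closedBall)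

lemma exists_radius {m : ℕ} {c : Fin m → ℂ} {r : Fin m → ℝ} (hr : ∀ i, 0 < r i)
    (hsub : ∀ i, closedBall (c i) (r i) ⊆ ball (0 : ℂ) 1)
    (hdisj : ∀ i j, i ≠ j → Disjoint (closedBall (c i) (r i)) (closedBall (c j) (r j)))
    (i : Fin m) : ∃ R, r i < R ∧ closedBall (c i) R ⊆ ball (0 : ℂ) 1 ∧
      ∀ j, j ≠ i → Disjoint (closedBall (c i) R) (closedBall (c j) (r j)) := by
  set V : Set ℂ := ball (0 : ℂ) 1 \ ⋃ j ∈ {j | j ≠ i}, closedBall (c j) (r j) with hV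
  have hVo : IsOpen V :=
    isOpen_ball.sdiff ((toFinite _).isClosed_biUnion fun _ _ => isClosed_closedBall)
  have hsubV : closedBall (c i) (r i) ⊆ V := by
    refine fun z hz => ⟨hsub i hz, fun hz' => ?_⟩
    simp only [mem_iUnion] at hz'
    obtain ⟨j, hj, hzj⟩ := hz'
    exact disjoint_left.1 (hdisj i j (Ne.symm hj)) hz hzj
  obtain ⟨δ, hδ, hδV⟩ := (isCompact_closedBall (c i) (r i)).exists_cthickening_subset_open hVo hsubV
  rw [cthickening_closedBall hδ.le (hr i).le] at hδV
  refine ⟨δ + r i, by linarith, fun z hz => (hδV hz).1, fun j hj => ?_⟩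
  rw [disjoint_left]
  intro z hz hz'
  exact (hδV hz).2 (mem_biUnion (show j ∈ {j | j ≠ i} from hj) hz')

lemma annulus_subset_holedDisc {m : ℕ} {c : Fin m → ℂ} {r : Fin m → ℝ} {i : Fin m} {R : ℝ}
    (hR : closedBall (c i) R ⊆ ball (0 : ℂ) 1)
    (hRd : ∀ j, j ≠ i → Disjoint (closedBall (c i) R) (closedBall (c j) (r j))) :
    {z | r i < ‖z - c i‖ ∧ ‖z - c i‖ ≤ R} ⊆ HoledDisc m c r := by
  rintro z ⟨hz, hz'⟩
  rw [← dist_eq_norm] at hz hz'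
  refine ⟨hR hz', fun h => ?_⟩
  obtain ⟨j, hj⟩ := mem_iUnion.1 h
  by_cases hji : j = i
  · subst hji
    exact absurd hz (not_lt.2 hj)
  · exact disjoint_left.1 (hRd j hji) hz' hj

/-- Glue a function on the holed disc with functions on discs slightly larger than the holes. -/
lemma exists_glue {m : ℕ} {c : Fin m → ℂ} {r : Fin m → ℝ} {X : Type*} {R : Fin m → ℝ}
    (hRd : ∀ i j, j ≠ i → Disjoint (closedBall (c i) (R i)) (closedBall (c j) (r j)))
    (g : ℂ → X) (q : Fin m → ℂ → X)
    (hgq : ∀ i z, r i < ‖z - c i‖ → ‖z - c i‖ < R i → g z = q i z) :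
    ∃ G : ℂ → X, EqOn G g (HoledDisc m c r) ∧ ∀ i, EqOn G (q i) (ball (c i) (R i)) := by
  classical
  refine ⟨fun z => if h : ∃ i, z ∈ closedBall (c i) (r i) then q h.choose z else g z, ?_, ?_⟩
  · intro z hz
    have : ¬ ∃ i, z ∈ closedBall (c i) (r i) := fun ⟨i, hi⟩ => hz.2 (mem_iUnion.2 ⟨i, hi⟩)
    simp only [dif_neg this]
  · intro i z hz
    by_cases h : ∃ i, z ∈ closedBall (c i) (r i)
    · have hi : h.choose = i := by
        by_contra hne
        exact disjoint_left.1 (hRd i _ hne) (ball_subset_closedBall hz) h.choose_spec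
      simp only [dif_pos h, hi]
    · have h1 : z ∉ closedBall (c i) (r i) := fun h2 => h ⟨i, h2⟩
      simp only [dif_neg h]
      rw [mem_closedBall, not_le, dist_eq_norm] at h1
      rw [mem_ball, dist_eq_norm] at hz
      exact hgq i z h1 hz

lemma mem_holedDisc_or {m : ℕ} {c : Fin m → ℂ} {r : Fin m → ℝ} {z : ℂ} (hz : z ∈ ball (0 : ℂ) 1) :
    z ∈ HoledDisc m c r ∨ ∃ i, z ∈ closedBall (c i) (r i) := by
  by_cases h : ∃ i, z ∈ closedBall (c i) (r i)
  · exact Or.inr h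
  · exact Or.inl ⟨hz, fun h' => h (mem_iUnion.1 h')⟩

lemma norm_sub_pos_of_mem {m : ℕ} {c : Fin m → ℂ} {r : Fin m → ℝ} {z : ℂ}
    (hz : z ∈ HoledDisc m c r) (i : Fin m) : r i < ‖z - c i‖ := by
  rw [← dist_eq_norm]
  by_contra h
  exact hz.2 (mem_iUnion.2 ⟨i, not_lt.1 h⟩)

lemma isOpen_lt_norm_sub (c : ℂ) (r : ℝ) : IsOpen {z : ℂ | r < ‖z - c‖} :=
  isOpen_lt (by fun_prop) (by fun_prop)

/-- Holomorphic functions on the holed disc have a primitive up to residue terms. -/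
lemma exists_eq_sum_add_deriv {m : ℕ} {c : Fin m → ℂ} {r : Fin m → ℝ} (hr : ∀ i, 0 < r i)
    (hsub : ∀ i, closedBall (c i) (r i) ⊆ ball (0 : ℂ) 1)
    (hdisj : ∀ i j, i ≠ j → Disjoint (closedBall (c i) (r i)) (closedBall (c j) (r j)))
    {f : ℂ → ℂ} (hf : DifferentiableOn ℂ f (HoledDisc m c r)) :
    ∃ (a : Fin m → ℂ) (F : ℂ → ℂ), DifferentiableOn ℂ F (HoledDisc m c r) ∧
      ∀ z ∈ HoledDisc m c r, f z = ∑ i, a i / (z - c i) + deriv F z := by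
  choose R₀ hR₀ hR₀b hR₀d using exists_radius hr hsub hdisj
  have hann : ∀ i, DifferentiableOn ℂ f {z | r i < ‖z - c i‖ ∧ ‖z - c i‖ < R₀ i} := fun i =>
    hf.mono fun z hz => annulus_subset_holedDisc (hR₀b i) (hR₀d i) ⟨hz.1, hz.2.le⟩
  choose R hR p P a hp hP hfp using fun i => exists_laurent (hr i) (hR₀ i) (hann i)
  have hRsub : ∀ i, closedBall (c i) (R i) ⊆ closedBall (c i) (R₀ i) := fun i =>
    closedBall_subset_closedBall (hR i).2.le
  let s : Fin m → ℂ → ℂ := fun j z => a j / (z - c j) + deriv (P j) z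
  have hs : ∀ j z, r j < ‖z - c j‖ → DifferentiableAt ℂ (s j) z := by
    intro j z hz
    have h0 : z - c j ≠ 0 := norm_pos_iff.1 ((hr j).trans hz)
    have h1 : DifferentiableAt ℂ (deriv (P j)) z :=
      ((hP j).deriv (isOpen_lt_norm_sub _ _)).differentiableAt
        ((isOpen_lt_norm_sub _ _).mem_nhds hz)
    have h2 : DifferentiableAt ℂ (fun z => a j / (z - c j)) z :=
      DifferentiableAt.fun_div (by fun_prop) (by fun_prop) h0
    exact h2.fun_add h1
  obtain ⟨G, hGg, hGq⟩ := exists_glue (r := r) (R := R)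
    (fun i j hj => (hR₀d i j hj).mono_left (hRsub i)) (fun z => f z - ∑ j, s j z)
    (fun i z => p i z - ∑ j ∈ Finset.univ.erase i, s j z) (by
      intro i z hz hz'
      rw [hfp i z hz hz', ← Finset.add_sum_erase _ _ (Finset.mem_univ i)]
      simp only [s]
      ring)
  have hG : DifferentiableOn ℂ G (ball 0 1) := by
    intro z hz
    refine DifferentiableAt.differentiableWithinAt ?_
    rcases mem_holedDisc_or (c := c) (r := r) hz with hz' | ⟨i, hi⟩
    · have hm := (isOpen_holedDisc m c r).mem_nhds hz'
      refine DifferentiableAt.congr_of_eventuallyEq ?_ (hGg.eventuallyEq_of_mem hm)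
      exact (hf.differentiableAt hm).sub
        (DifferentiableAt.fun_sum fun j _ => hs j z (norm_sub_pos_of_mem hz' j))
    · have hi' : z ∈ ball (c i) (R i) := closedBall_subset_ball (hR i).1 hi
      have hm := isOpen_ball.mem_nhds hi'
      refine DifferentiableAt.congr_of_eventuallyEq ?_ ((hGq i).eventuallyEq_of_mem hm)
      refine ((hp i).differentiableAt hm).sub (DifferentiableAt.fun_sum fun j hj => hs j z ?_)
      have := disjoint_left.1 (hdisj i j (Finset.ne_of_mem_erase hj).symm) hi
      rwa [mem_closedBall, not_le, dist_eq_norm] at this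
  obtain ⟨F, hF⟩ := hG.isExactOn_ball
  have hPd : ∀ z ∈ HoledDisc m c r, ∀ j, DifferentiableAt ℂ (P j) z := fun z hz j =>
    (hP j).differentiableAt ((isOpen_lt_norm_sub _ _).mem_nhds (norm_sub_pos_of_mem hz j))
  have hd : ∀ z ∈ HoledDisc m c r,
      HasDerivAt (fun z => F z + ∑ j, P j z) (G z + ∑ j, deriv (P j) z) z := fun z hz =>
    (hF z hz.1).fun_add (HasDerivAt.fun_sum fun j _ => (hPd z hz j).hasDerivAt)
  refine ⟨a, fun z => F z + ∑ j, P j z,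
    fun z hz => (hd z hz).differentiableAt.differentiableWithinAt, fun z hz => ?_⟩
  rw [(hd z hz).deriv, hGg hz]
  simp only [s, Finset.sum_add_distrib]
  ring

lemma exists_int_eq_of_logDeriv {h S : ℂ → ℂ} {c a : ℂ} {ρ : ℝ} (hρ : 0 < ρ)
    (hh : ∀ z ∈ sphere c ρ, DifferentiableAt ℂ h z) (hS : ∀ z ∈ sphere c ρ, DifferentiableAt ℂ S z)
    (hne : ∀ z ∈ sphere c ρ, h z ≠ 0)
    (heq : ∀ z ∈ sphere c ρ, deriv h z / h z = a / (z - c) + deriv S z) : ∃ n : ℤ, a = n := by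
  let γ := circleMap c ρ
  have hγ : ∀ θ, γ θ ∈ sphere c ρ := fun θ => circleMap_mem_sphere c hρ.le θ
  have hγ' : ∀ θ, HasDerivAt γ (circleMap 0 ρ θ * Complex.I) θ := hasDerivAt_circleMap c ρ
  let u : ℝ → ℂ := fun θ => h (γ θ) * Complex.exp (-(S (γ θ)) - a * Complex.I * θ)
  have hu : ∀ θ, HasDerivAt u 0 θ := by
    intro θ
    have h1 : HasDerivAt (fun θ => h (γ θ)) (deriv h (γ θ) * (circleMap 0 ρ θ * Complex.I)) θ :=
      (hh _ (hγ θ)).hasDerivAt.comp_of_eq θ (hγ' θ) rfl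
    have h2 : HasDerivAt (fun θ => S (γ θ)) (deriv S (γ θ) * (circleMap 0 ρ θ * Complex.I)) θ :=
      (hS _ (hγ θ)).hasDerivAt.comp_of_eq θ (hγ' θ) rfl
    have h3 : HasDerivAt (fun θ : ℝ => a * Complex.I * (θ : ℂ)) (a * Complex.I * 1) θ :=
      (Complex.ofRealCLM.hasDerivAt (x := θ)).const_mul _
    refine (h1.fun_mul (h2.fun_neg.fun_sub h3).cexp).congr_deriv ?_
    have h4 := heq _ (hγ θ)
    have h5 := hne _ (hγ θ)
    have h6 : γ θ - c = circleMap 0 ρ θ := by simp [γ, circleMap]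
    have h7 : circleMap 0 ρ θ ≠ 0 := by simp [circleMap, hρ.ne']
    rw [h6, div_eq_iff h5] at h4
    rw [h4]
    field_simp
    ring
  have hc : u (2 * π) = u 0 :=
    is_const_of_deriv_eq_zero (fun θ => (hu θ).differentiableAt) (fun θ => (hu θ).deriv) _ _
  have hper : γ (2 * π) = γ 0 := by
    have := periodic_circleMap c ρ 0
    rwa [zero_add] at this
  simp only [u, hper] at hc
  have hc' := mul_left_cancel₀ (hne _ (hγ 0)) hc
  obtain ⟨n, hn⟩ := Complex.exp_eq_exp_iff_exists_int.1 hc'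
  refine ⟨-n, ?_⟩
  have hI := Complex.two_pi_I_ne_zero
  push_cast at hn ⊢
  refine mul_right_cancel₀ hI ?_
  linear_combination -hn

/-- The residues of a logarithmic derivative are integers. -/
lemma exists_int_residue {m : ℕ} {c : Fin m → ℂ} {r : Fin m → ℝ} (hr : ∀ i, 0 < r i)
    (hsub : ∀ i, closedBall (c i) (r i) ⊆ ball (0 : ℂ) 1)
    (hdisj : ∀ i j, i ≠ j → Disjoint (closedBall (c i) (r i)) (closedBall (c j) (r j)))
    {h F : ℂ → ℂ} {a : Fin m → ℂ} (hh : DifferentiableOn ℂ h (HoledDisc m c r))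
    (hF : DifferentiableOn ℂ F (HoledDisc m c r)) (hne : ∀ z ∈ HoledDisc m c r, h z ≠ 0)
    (heq : ∀ z ∈ HoledDisc m c r, deriv h z / h z = ∑ i, a i / (z - c i) + deriv F z) (i : Fin m) :
    ∃ n : ℤ, a i = n := by
  obtain ⟨R, hR, hRb, hRd⟩ := exists_radius hr hsub hdisj i
  obtain ⟨ρ, h1, h2⟩ := exists_between hR
  have hs : sphere (c i) ρ ⊆ HoledDisc m c r := by
    intro z hz
    rw [mem_sphere, dist_eq_norm] at hz
    exact annulus_subset_holedDisc hRb hRd ⟨by rw [hz]; exact h1, by rw [hz]; exact h2.le⟩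
  have hΩ := isOpen_holedDisc m c r
  have hK : DifferentiableOn ℂ (fun z => ∑ j ∈ Finset.univ.erase i, a j / (z - c j))
      (ball (c i) R) := by
    refine DifferentiableOn.fun_sum fun j hj => DifferentiableOn.fun_div (by fun_prop) (by fun_prop) ?_
    intro z hz h0
    refine disjoint_left.1 (hRd j (Finset.ne_of_mem_erase hj)) (ball_subset_closedBall hz) ?_
    rw [sub_eq_zero.1 h0]
    exact mem_closedBall_self (hr j).le
  obtain ⟨G, hG⟩ := hK.isExactOn_ball
  have hsR : ∀ z ∈ sphere (c i) ρ, z ∈ ball (c i) R := fun z hz => by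
    rw [mem_ball, mem_sphere.1 hz]; exact h2
  have hFz : ∀ z ∈ sphere (c i) ρ, DifferentiableAt ℂ F z := fun z hz =>
    hF.differentiableAt (hΩ.mem_nhds (hs hz))
  refine exists_int_eq_of_logDeriv (S := fun z => G z + F z) ((hr i).trans h1)
    (fun z hz => hh.differentiableAt (hΩ.mem_nhds (hs hz)))
    (fun z hz => (hG z (hsR z hz)).differentiableAt.fun_add (hFz z hz))
    (fun z hz => hne z (hs hz)) fun z hz => ?_
  rw [heq z (hs hz), ← Finset.add_sum_erase _ _ (Finset.mem_univ i),
    ((hG z (hsR z hz)).fun_add (hFz z hz).hasDerivAt).deriv]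
  ring

lemma isPreconnected_annulus (c : ℂ) {a b : ℝ} (ha : 0 ≤ a) :
    IsPreconnected {z : ℂ | a < ‖z - c‖ ∧ ‖z - c‖ < b} := by
  have h : {z : ℂ | a < ‖z - c‖ ∧ ‖z - c‖ < b}
      = (fun x : ℝ × ℝ => circleMap c x.1 x.2) '' (Ioo a b ×ˢ univ) := by
    ext z
    simp only [mem_ofPred_eq, mem_image, mem_prod, mem_Ioo, mem_univ, and_true, Prod.exists]
    constructor
    · intro hz
      refine ⟨‖z - c‖, Complex.arg (z - c), hz, ?_⟩
      rw [circleMap, Complex.norm_mul_exp_arg_mul_I, add_sub_cancel]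
    · rintro ⟨ρ, θ, h, rfl⟩
      have : ‖circleMap c ρ θ - c‖ = ρ := by
        simp [circleMap, abs_of_pos (ha.trans_lt h.1)]
      rwa [this]
  rw [h]
  refine (isPreconnected_Ioo.prod isPreconnected_univ).image _ (Continuous.continuousOn ?_)
  unfold circleMap
  fun_prop

lemma isPreconnected_holedDisc {m : ℕ} {c : Fin m → ℂ} {r : Fin m → ℝ} (hr : ∀ i, 0 < r i)
    (hsub : ∀ i, closedBall (c i) (r i) ⊆ ball (0 : ℂ) 1)
    (hdisj : ∀ i j, i ≠ j → Disjoint (closedBall (c i) (r i)) (closedBall (c j) (r j))) :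
    IsPreconnected (HoledDisc m c r) := by
  refine isPreconnected_of_forall_constant fun f hf x hx y hy => ?_
  choose R hR hRb hRd using exists_radius hr hsub hdisj
  have hb : ∀ i, ∃ b, ∀ z, r i < ‖z - c i‖ → ‖z - c i‖ < R i → f z = b := by
    intro i
    by_cases h : ∃ z, r i < ‖z - c i‖ ∧ ‖z - c i‖ < R i
    · obtain ⟨z₀, h₀⟩ := h
      refine ⟨f z₀, fun z hz hz' => ?_⟩
      refine (isPreconnected_annulus (c i) (hr i).le).constant (hf.mono fun w hw => ?_)
        ⟨hz, hz'⟩ h₀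
      exact annulus_subset_holedDisc (hRb i) (hRd i) ⟨hw.1, hw.2.le⟩
    · exact ⟨true, fun z hz hz' => absurd ⟨z, hz, hz'⟩ h⟩
  choose b hb using hb
  obtain ⟨G, hGf, hGq⟩ := exists_glue (r := r) (R := R) hRd f (fun i _ => b i) hb
  have hG : ContinuousOn G (ball 0 1) := by
    intro z hz
    refine ContinuousAt.continuousWithinAt ?_
    rcases mem_holedDisc_or (c := c) (r := r) hz with hz' | ⟨i, hi⟩
    · have hm := (isOpen_holedDisc m c r).mem_nhds hz'
      exact (hf.continuousAt hm).congr (hGf.eventuallyEq_of_mem hm).symm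
    · have hm := isOpen_ball.mem_nhds (closedBall_subset_ball (hR i) hi)
      exact continuousAt_const.congr ((hGq i).eventuallyEq_of_mem hm).symm
  rw [← hGf hx, ← hGf hy]
  exact (convex_ball (0 : ℂ) 1).isPreconnected.constant hG hx.1 hy.1

/-- Pullback of the holomorphic one-form `g dz` under `φ`. -/
noncomputable def pullback (φ g : ℂ → ℂ) : ℂ → ℂ := fun z => g (φ z) * deriv φ z

lemma differentiableOn_pullback {φ g : ℂ → ℂ} {U : Set ℂ} (hU : IsOpen U)
    (hφ : DifferentiableOn ℂ φ U) (hm : MapsTo φ U U) (hg : DifferentiableOn ℂ g U) :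
    DifferentiableOn ℂ (pullback φ g) U :=
  (hg.comp hφ hm).mul (hφ.deriv hU)

lemma eLpNorm_two_eq (f : ℂ → ℂ) (μ : Measure ℂ) :
    eLpNorm f 2 μ = (∫⁻ z, ‖f z‖ₑ ^ 2 ∂μ) ^ (1 / 2 : ℝ) := by
  rw [eLpNorm_eq_lintegral_rpow_enorm_toReal (by simp) (by simp)]
  simp

lemma eLpNorm_pullback {φ : ℂ → ℂ} {U : Set ℂ} (hU : IsOpen U) (hφ : DifferentiableOn ℂ φ U)
    (hbij : BijOn φ U U) (g : ℂ → ℂ) :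
    eLpNorm (pullback φ g) 2 (volume.restrict U) = eLpNorm g 2 (volume.restrict U) := by
  rw [eLpNorm_two_eq, eLpNorm_two_eq]
  unfold pullback
  rw [setLIntegral_pullback hU hφ hbij.injOn hU.measurableSet subset_rfl, hbij.image_eq]

lemma memLp_pullback {φ g : ℂ → ℂ} {U : Set ℂ} (hU : IsOpen U) (hφ : DifferentiableOn ℂ φ U)
    (hbij : BijOn φ U U) (hg : DifferentiableOn ℂ g U) (hgm : MemLp g 2 (volume.restrict U)) :
    MemLp (pullback φ g) 2 (volume.restrict U) := by
  refine ⟨(differentiableOn_pullback hU hφ hbij.mapsTo hg).continuousOn.aestronglyMeasurable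
    hU.measurableSet, ?_⟩
  rw [eLpNorm_pullback hU hφ hbij]
  exact hgm.2

lemma pullback_deriv {φ F : ℂ → ℂ} {U : Set ℂ} (hU : IsOpen U) (hφ : DifferentiableOn ℂ φ U)
    (hm : MapsTo φ U U) (hF : DifferentiableOn ℂ F U) :
    EqOn (pullback φ (deriv F)) (deriv (F ∘ φ)) U := fun z hz =>
  (((hF.differentiableAt (hU.mem_nhds (hm hz))).hasDerivAt.comp z
    (hφ.differentiableAt (hU.mem_nhds hz)).hasDerivAt).deriv).symm

/-- The square integrable exact holomorphic one-forms. -/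
def exactForms (U : Set ℂ) : Submodule ℂ (Lp ℂ 2 (volume.restrict U)) where
  carrier := {u | ∃ F, DifferentiableOn ℂ F U ∧
    ∀ᵐ z ∂volume.restrict U, HasDerivAt F (u z) z}
  add_mem' := by
    rintro u v ⟨F, hF, hu⟩ ⟨G, hG, hv⟩
    refine ⟨fun z => F z + G z, hF.fun_add hG, ?_⟩
    filter_upwards [hu, hv, Lp.coeFn_add u v] with z h1 h2 h3
    rw [h3]
    exact h1.fun_add h2
  zero_mem' := by
    refine ⟨fun _ => 0, differentiableOn_const 0, ?_⟩
    filter_upwards [Lp.coeFn_zero ℂ 2 (volume.restrict U)] with z h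
    rw [h]
    exact hasDerivAt_const z 0
  smul_mem' := by
    rintro a u ⟨F, hF, hu⟩
    refine ⟨fun z => a * F z, hF.const_mul a, ?_⟩
    filter_upwards [hu, Lp.coeFn_smul a u] with z h1 h2
    rw [h2]
    exact h1.const_mul a

lemma mem_exactForms_iff {U : Set ℂ} (hU : IsOpen U) {u : Lp ℂ 2 (volume.restrict U)} :
    u ∈ exactForms U ↔ ∃ F, DifferentiableOn ℂ F U ∧ u =ᵐ[volume.restrict U] deriv F := by
  refine exists_congr fun F => and_congr_right fun hF => ⟨fun h => ?_, fun h => ?_⟩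
  · filter_upwards [h] with z hz using hz.deriv.symm
  · filter_upwards [h, ae_restrict_mem hU.measurableSet] with z hz hzU
    rw [hz]
    exact (hF.differentiableAt (hU.mem_nhds hzU)).hasDerivAt

lemma exists_differentiableOn_of_mem_closure {U : Set ℂ} (hU : IsOpen U)
    {u : Lp ℂ 2 (volume.restrict U)} (hu : u ∈ (exactForms U).topologicalClosure) :
    ∃ g, DifferentiableOn ℂ g U ∧ u =ᵐ[volume.restrict U] g := by
  rw [← SetLike.mem_coe, Submodule.topologicalClosure_coe, mem_closure_iff_seq_limit] at hu
  obtain ⟨v, hv, hvu⟩ := hu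
  choose F hF hvF using fun n => (mem_exactForms_iff hU).1 (hv n)
  exact exists_differentiableOn_of_tendsto_Lp hU hvu (fun n => (hF n).deriv hU) hvF

/-- Decomposition of a holomorphic form into a limit of exact forms and a form orthogonal to
the exact forms. -/
lemma exists_decomposition {p : ℂ → ℂ} {U : Set ℂ} (hU : IsOpen U)
    (hpm : MemLp p 2 (volume.restrict U)) :
    ∃ (e : ℂ → ℂ) (he : MemLp e 2 (volume.restrict U)), DifferentiableOn ℂ e U ∧
      he.toLp e ∈ (exactForms U).topologicalClosure ∧
      (hpm.sub he).toLp (p - e) ∈ (exactForms U)ᗮ := by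
  set K := (exactForms U).topologicalClosure with hK
  have : CompleteSpace K := (Submodule.isClosed_topologicalClosure _).completeSpace_coe
  set u := K.starProjection (hpm.toLp p) with hu
  have huK : u ∈ K := Submodule.starProjection_apply_mem _ _
  obtain ⟨e, he, hue⟩ := exists_differentiableOn_of_mem_closure hU huK
  have hem : MemLp e 2 (volume.restrict U) := (memLp_congr_ae hue).1 (Lp.memLp u)
  have h1 : hem.toLp e = u := by
    rw [← Lp.toLp_coeFn u (Lp.memLp u)]
    exact MemLp.toLp_congr _ _ hue.symm
  refine ⟨e, hem, he, h1 ▸ huK, ?_⟩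
  rw [MemLp.toLp_sub hpm hem, h1, ← Submodule.orthogonal_closure, ← hK]
  exact Submodule.sub_starProjection_mem_orthogonal _

lemma pullback_mem_closure {φ e : ℂ → ℂ} {U : Set ℂ} (hU : IsOpen U)
    (hφ : DifferentiableOn ℂ φ U) (hbij : BijOn φ U U) (he : DifferentiableOn ℂ e U)
    (hem : MemLp e 2 (volume.restrict U)) (hK : hem.toLp e ∈ (exactForms U).topologicalClosure) :
    (memLp_pullback hU hφ hbij he hem).toLp (pullback φ e) ∈ (exactForms U).topologicalClosure := by
  rw [← SetLike.mem_coe, Submodule.topologicalClosure_coe, Metric.mem_closure_iff] at hK ⊢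
  intro ε hε
  obtain ⟨u, hu, hue⟩ := hK ε hε
  obtain ⟨F, hF, huF⟩ := (mem_exactForms_iff hU).1 hu
  have hF' := hF.deriv hU
  have hFm : MemLp (deriv F) 2 (volume.restrict U) := (memLp_congr_ae huF).1 (Lp.memLp u)
  have h1 : hFm.toLp (deriv F) = u := by
    rw [← Lp.toLp_coeFn u (Lp.memLp u)]
    exact MemLp.toLp_congr _ _ huF.symm
  refine ⟨(memLp_pullback hU hφ hbij hF' hFm).toLp _, ?_, ?_⟩
  · refine (mem_exactForms_iff hU).2 ⟨F ∘ φ, hF.comp hφ hbij.mapsTo, ?_⟩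
    refine (MemLp.coeFn_toLp _).trans ?_
    filter_upwards [ae_restrict_mem hU.measurableSet] with z hz
    exact pullback_deriv hU hφ hbij.mapsTo hF hz
  · rw [← h1] at hue
    rw [dist_eq_norm, ← MemLp.toLp_sub, Lp.norm_toLp] at hue ⊢
    have h2 : pullback φ e - pullback φ (deriv F) = pullback φ (e - deriv F) := by
      ext z
      simp only [pullback, Pi.sub_apply]
      ring
    rwa [h2, eLpNorm_pullback hU hφ hbij]

lemma pullback_mem_orthogonal {φ g : ℂ → ℂ} {U : Set ℂ} (hU : IsOpen U)
    (hφ : DifferentiableOn ℂ φ U) (hbij : BijOn φ U U) (hg : DifferentiableOn ℂ g U)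
    (hgm : MemLp g 2 (volume.restrict U)) (hK : hgm.toLp g ∈ (exactForms U)ᗮ) :
    (memLp_pullback hU hφ hbij hg hgm).toLp (pullback φ g) ∈ (exactForms U)ᗮ := by
  obtain ⟨ψ, hψ, hψm, h1, h2⟩ := exists_inverse hU hφ hbij
  rw [Submodule.mem_orthogonal] at hK ⊢
  intro u hu
  obtain ⟨F, hF, huF⟩ := (mem_exactForms_iff hU).1 hu
  have hG : DifferentiableOn ℂ (F ∘ ψ) U := hF.comp hψ hψm
  have hpb : EqOn (pullback φ (deriv (F ∘ ψ))) (deriv F) U := by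
    intro z hz
    rw [pullback_deriv hU hφ hbij.mapsTo hG hz]
    refine Filter.EventuallyEq.deriv_eq ?_
    filter_upwards [hU.mem_nhds hz] with w hw
    simp only [Function.comp_apply, h2 w hw]
  have hpb' : pullback φ (deriv (F ∘ ψ)) =ᵐ[volume.restrict U] u := by
    filter_upwards [huF, ae_restrict_mem hU.measurableSet] with z h3 h4
    rw [hpb h4, h3]
  have hGm : MemLp (deriv (F ∘ ψ)) 2 (volume.restrict U) := by
    refine ⟨(hG.deriv hU).continuousOn.aestronglyMeasurable hU.measurableSet, ?_⟩
    rw [← eLpNorm_pullback hU hφ hbij, eLpNorm_congr_ae hpb']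
    exact (Lp.memLp u).2
  have h3 := hK (hGm.toLp _) ((mem_exactForms_iff hU).2 ⟨F ∘ ψ, hG, hGm.coeFn_toLp⟩)
  rw [L2.inner_def] at h3 ⊢
  have h4 : ∫ z in U, (starRingEnd ℂ) (deriv (F ∘ ψ) z) * g z = 0 := by
    rw [← h3]
    refine integral_congr_ae ?_
    filter_upwards [hGm.coeFn_toLp, hgm.coeFn_toLp] with z h5 h6
    rw [h5, h6, RCLike.inner_apply']
  rw [← setIntegral_pullback hU hφ hbij] at h4
  rw [← h4]
  refine integral_congr_ae ?_
  filter_upwards [hpb', (memLp_pullback hU hφ hbij hg hgm).coeFn_toLp] with z h5 h6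
  rw [← h5, h6, RCLike.inner_apply', pullback, pullback]

lemma coeFn_sum_smul_toLp {m : ℕ} {μ : Measure ℂ} {f : Fin m → ℂ → ℂ} (hf : ∀ i, MemLp (f i) 2 μ)
    (a : Fin m → ℂ) :
    ⇑(∑ i, a i • (hf i).toLp (f i)) =ᵐ[μ] fun z => ∑ i, a i * f i z := by
  filter_upwards [Lp.coeFn_finsetSum Finset.univ fun i => a i • (hf i).toLp (f i),
    eventually_all.2 fun i => Lp.coeFn_smul (a i) ((hf i).toLp (f i)),
    eventually_all.2 fun i => (hf i).coeFn_toLp] with z h1 h2 h3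
  rw [h1, Finset.sum_apply]
  refine Finset.sum_congr rfl fun i _ => ?_
  rw [h2 i, Pi.smul_apply, h3 i, smul_eq_mul]

section

variable {m : ℕ} {c : Fin m → ℂ} {r : Fin m → ℝ}

lemma isFiniteMeasure_holedDisc : IsFiniteMeasure (volume.restrict (HoledDisc m c r)) :=
  ⟨by
    rw [Measure.restrict_apply_univ]
    exact (measure_mono sdiff_subset).trans_lt measure_ball_lt_top⟩

lemma sub_ne_zero_of_mem (hr : ∀ i, 0 < r i) {z : ℂ} (hz : z ∈ HoledDisc m c r) (i : Fin m) :
    z - c i ≠ 0 :=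
  norm_pos_iff.1 ((hr i).trans (norm_sub_pos_of_mem hz i))

lemma differentiableOn_inv_sub (hr : ∀ i, 0 < r i) (i : Fin m) :
    DifferentiableOn ℂ (fun z => (z - c i)⁻¹) (HoledDisc m c r) :=
  DifferentiableOn.fun_inv (by fun_prop) fun _ hz => sub_ne_zero_of_mem hr hz i

lemma memLp_inv_sub (hr : ∀ i, 0 < r i) (i : Fin m) :
    MemLp (fun z => (z - c i)⁻¹) 2 (volume.restrict (HoledDisc m c r)) := by
  have := isFiniteMeasure_holedDisc (c := c) (r := r)
  refine MemLp.of_bound ((differentiableOn_inv_sub hr i).continuousOn.aestronglyMeasurable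
    (isOpen_holedDisc m c r).measurableSet) (r i)⁻¹ ?_
  filter_upwards [ae_restrict_mem (isOpen_holedDisc m c r).measurableSet] with z hz
  rw [norm_inv]
  exact inv_anti₀ (hr i) (norm_sub_pos_of_mem hz i).le

/-- The residue around a hole is given by pairing with an element of the Hilbert space. -/
lemma exists_residue_functional (hr : ∀ i, 0 < r i)
    (hsub : ∀ i, closedBall (c i) (r i) ⊆ ball (0 : ℂ) 1)
    (hdisj : ∀ i j, i ≠ j → Disjoint (closedBall (c i) (r i)) (closedBall (c j) (r j)))
    (i : Fin m) : ∃ (k : Lp ℂ 2 (volume.restrict (HoledDisc m c r))) (κ : ℂ), κ ≠ 0 ∧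
      k ∈ (exactForms (HoledDisc m c r))ᗮ ∧
      ∀ j, ⟪k, (memLp_inv_sub hr j).toLp _⟫_ℂ = if j = i then κ else 0 := by
  obtain ⟨R, hR, hRb, hRd⟩ := exists_radius hr hsub hdisj i
  obtain ⟨a, h1, h2⟩ := exists_between hR
  obtain ⟨b, h3, h4⟩ := exists_between h2
  have hΩ := isOpen_holedDisc m c r
  have ha0 : 0 < a := (hr i).trans h1
  have hcl : {z | a ≤ ‖z - c i‖ ∧ ‖z - c i‖ ≤ b} ⊆ HoledDisc m c r := fun z hz =>
    annulus_subset_holedDisc hRb hRd ⟨h1.trans_le hz.1, hz.2.trans h4.le⟩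
  obtain ⟨k, hk⟩ := exists_inner_eq_setIntegral_annulus (c i) a b
    (fun z hz => hcl ⟨hz.1.le, hz.2.le⟩ : _ ⊆ HoledDisc m c r)
  have hsph : ∀ ρ ∈ Ioo a b, ∀ z ∈ sphere (c i) ρ, z ∈ HoledDisc m c r := by
    intro ρ hρ z hz
    rw [mem_sphere, dist_eq_norm] at hz
    exact hcl ⟨by rw [hz]; exact hρ.1.le, by rw [hz]; exact hρ.2.le⟩
  have hmain : ∀ (f : ℂ → ℂ) (L : ℂ), DifferentiableOn ℂ f (HoledDisc m c r) →
      (∀ ρ ∈ Ioo a b, ∮ z in C(c i, ρ), f z = L) → ∀ u : Lp ℂ 2 (volume.restrict (HoledDisc m c r)),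
      u =ᵐ[volume.restrict (HoledDisc m c r)] f →
      ⟪k, u⟫_ℂ = ((b ^ 2 - a ^ 2) / 2 : ℝ) • (-Complex.I * L) := by
    intro f L hf hL u hu
    rw [hk u f hu]
    exact setIntegral_annulus_mul_sub ha0.le h3.le (hf.continuousOn.mono hcl) hL
  refine ⟨k, ((b ^ 2 - a ^ 2) / 2 : ℝ) • (-Complex.I * (2 * π * Complex.I)), ?_, ?_, fun j => ?_⟩
  · have : (b ^ 2 - a ^ 2) / 2 ≠ 0 := by
      have : a ^ 2 < b ^ 2 := pow_lt_pow_left₀ h3 ha0.le two_ne_zero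
      linarith
    refine smul_ne_zero this (mul_ne_zero (by simp) Complex.two_pi_I_ne_zero)
  · rw [Submodule.mem_orthogonal']
    intro u hu
    obtain ⟨F, hF, huF⟩ := (mem_exactForms_iff hΩ).1 hu
    rw [hmain (deriv F) 0 (hF.deriv hΩ) ?_ u huF]
    · simp
    · intro ρ hρ
      exact circleIntegral.integral_eq_zero_of_hasDerivWithinAt (ha0.trans hρ.1).le fun z hz =>
        (hF.differentiableAt (hΩ.mem_nhds (hsph ρ hρ z hz))).hasDerivAt.hasDerivWithinAt
  · by_cases hji : j = i
    · subst hji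
      rw [if_pos rfl]
      exact hmain _ _ (differentiableOn_inv_sub hr j)
        (fun ρ hρ => circleIntegral.integral_sub_center_inv _ (ha0.trans hρ.1).ne') _
        (MemLp.coeFn_toLp _)
    · rw [if_neg hji, hmain _ 0 (differentiableOn_inv_sub hr j) ?_ _ (MemLp.coeFn_toLp _)]
      · simp
      · intro ρ hρ
        refine DiffContOnCl.circleIntegral_eq_zero (ha0.trans hρ.1).le ?_
        refine DifferentiableOn.diffContOnCl ?_
        rw [closure_ball _ (ha0.trans hρ.1).ne']
        refine DifferentiableOn.fun_inv (by fun_prop) fun w hw h => ?_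
        rw [sub_eq_zero.1 h] at hw
        exact disjoint_left.1 (hRd j hji)
          (closedBall_subset_closedBall (hρ.2.trans h4).le hw) (mem_closedBall_self (hr j).le)

/-- Holomorphic one-forms on which automorphisms act through integer matrices with bounded
entries. -/
lemma exists_forms (hr : ∀ i, 0 < r i)
    (hsub : ∀ i, closedBall (c i) (r i) ⊆ ball (0 : ℂ) 1)
    (hdisj : ∀ i j, i ≠ j → Disjoint (closedBall (c i) (r i)) (closedBall (c j) (r j))) :
    ∃ (g : Fin m → ℂ → ℂ) (N : Fin m → Fin m → ℝ),
      (∀ j, DifferentiableOn ℂ (g j) (HoledDisc m c r)) ∧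
      (∀ j, MemLp (g j) 2 (volume.restrict (HoledDisc m c r))) ∧
      (∀ a : Fin m → ℂ, (∀ z ∈ HoledDisc m c r, ∑ i, a i * g i z = 0) → ∀ i, a i = 0) ∧
      ∀ φ, DifferentiableOn ℂ φ (HoledDisc m c r) →
        BijOn φ (HoledDisc m c r) (HoledDisc m c r) →
        ∃ n : Fin m → Fin m → ℤ, (∀ j i, |(n j i : ℝ)| ≤ N j i) ∧
          ∀ j, ∀ z ∈ HoledDisc m c r, pullback φ (g j) z = ∑ i, (n j i : ℂ) * g i z := by
  have hΩ := isOpen_holedDisc m c r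
  set Ω := HoledDisc m c r with hΩdef
  let p : Fin m → ℂ → ℂ := fun i z => (z - c i)⁻¹
  have hp : ∀ i, DifferentiableOn ℂ (p i) Ω := differentiableOn_inv_sub hr
  have hpm : ∀ i, MemLp (p i) 2 (volume.restrict Ω) := memLp_inv_sub hr
  choose e hem he heK hgK using fun i => exists_decomposition hΩ (hpm i)
  choose k κ hκ hkE hkp using exists_residue_functional hr hsub hdisj
  let g : Fin m → ℂ → ℂ := fun i => p i - e i
  have hg : ∀ i, DifferentiableOn ℂ (g i) Ω := fun i => (hp i).sub (he i)
  have hgm : ∀ i, MemLp (g i) 2 (volume.restrict Ω) := fun i => (hpm i).sub (hem i)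
  have hv : ∀ i, (hgm i).toLp (g i) = (hpm i).toLp (p i) - (hem i).toLp (e i) := fun i =>
    MemLp.toLp_sub (hpm i) (hem i)
  have hkg : ∀ i j, ⟪k i, (hgm j).toLp (g j)⟫_ℂ = if j = i then κ i else 0 := by
    intro i j
    have h1 : ⟪k i, (hem j).toLp (e j)⟫_ℂ = 0 := by
      have := hkE i
      rw [← Submodule.orthogonal_closure, Submodule.mem_orthogonal'] at this
      exact this _ (heK j)
    rw [hv, inner_sub_right, h1, sub_zero]
    exact hkp i j
  have hksum : ∀ i (a : Fin m → ℂ), ⟪k i, ∑ j, a j • (hgm j).toLp (g j)⟫_ℂ = a i * κ i := by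
    intro i a
    simp [inner_sum, inner_smul_right, hkg]
  refine ⟨g, fun j i => ‖k i‖ * ‖(hgm j).toLp (g j)‖ / ‖κ i‖, hg, hgm, fun a ha i => ?_,
    fun φ hφ hbij => ?_⟩
  · have h0 : ∑ j, a j • (hgm j).toLp (g j) = 0 := by
      refine Lp.ext ?_
      filter_upwards [coeFn_sum_smul_toLp hgm a, Lp.coeFn_zero ℂ 2 (volume.restrict Ω),
        ae_restrict_mem hΩ.measurableSet] with z h1 h2 h3
      rw [h1, h2, ha z h3, Pi.zero_apply]
    have := hksum i a
    rw [h0, inner_zero_right] at this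
    exact (mul_eq_zero.1 this.symm).resolve_right (hκ i)
  · have key : ∀ j, ∃ n : Fin m → ℤ, (memLp_pullback hΩ hφ hbij (hg j) (hgm j)).toLp _ =
        ∑ i, (n i : ℂ) • (hgm i).toLp (g i) := by
      intro j
      have hpb := differentiableOn_pullback hΩ hφ hbij.mapsTo (hp j)
      obtain ⟨a, F, hF, hpF⟩ := exists_eq_sum_add_deriv hr hsub hdisj hpb
      choose n hn using exists_int_residue hr hsub hdisj (h := fun z => φ z - c j)
        (hφ.sub_const _) hF (fun z hz => sub_ne_zero_of_mem hr (hbij.mapsTo hz) j)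
        (fun z hz => by
          rw [← hpF z hz, deriv_sub_const, pullback, div_eq_mul_inv, mul_comm])
      refine ⟨n, ?_⟩
      have hw := pullback_mem_orthogonal hΩ hφ hbij (hg j) (hgm j) (hgK j)
      have hB := pullback_mem_closure hΩ hφ hbij (he j) (hem j) (heK j)
      set w := (memLp_pullback hΩ hφ hbij (hg j) (hgm j)).toLp (pullback φ (g j)) with hwdef
      set A := (memLp_pullback hΩ hφ hbij (hp j) (hpm j)).toLp (pullback φ (p j)) with hA
      set B := (memLp_pullback hΩ hφ hbij (he j) (hem j)).toLp (pullback φ (e j)) with hBdef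
      have hwAB : w = A - B := by
        rw [hwdef, hA, hBdef, ← MemLp.toLp_sub]
        refine MemLp.toLp_congr _ _ (Eventually.of_forall fun z => ?_)
        simp only [pullback, g, Pi.sub_apply]
        ring
      have hD : A - ∑ i, (n i : ℂ) • (hpm i).toLp (p i) ∈ exactForms Ω := by
        refine (mem_exactForms_iff hΩ).2 ⟨F, hF, ?_⟩
        filter_upwards [Lp.coeFn_sub A (∑ i, (n i : ℂ) • (hpm i).toLp (p i)),
          (memLp_pullback hΩ hφ hbij (hp j) (hpm j)).coeFn_toLp,
          coeFn_sum_smul_toLp hpm (fun i => (n i : ℂ)),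
          ae_restrict_mem hΩ.measurableSet] with z h1 h2 h3 h4
        rw [h1, Pi.sub_apply, h3, hA, h2, hpF z h4, add_comm, add_sub_assoc]
        simp [hn, p, div_eq_mul_inv]
      have hK : w - ∑ i, (n i : ℂ) • (hgm i).toLp (g i) ∈ (exactForms Ω).topologicalClosure := by
        have : w - ∑ i, (n i : ℂ) • (hgm i).toLp (g i) =
            (A - ∑ i, (n i : ℂ) • (hpm i).toLp (p i)) - B +
              ∑ i, (n i : ℂ) • (hem i).toLp (e i) := by
          simp only [hv, hwAB, smul_sub, Finset.sum_sub_distrib]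
          abel
        rw [this]
        exact add_mem (sub_mem (Submodule.le_topologicalClosure _ hD) hB)
          (Submodule.sum_mem _ fun i _ => Submodule.smul_mem _ _ (heK i))
      have hK' : w - ∑ i, (n i : ℂ) • (hgm i).toLp (g i) ∈ (exactForms Ω)ᗮ :=
        sub_mem hw (Submodule.sum_mem _ fun i _ => Submodule.smul_mem _ _ (hgK i))
      rw [← Submodule.orthogonal_closure, Submodule.mem_orthogonal] at hK'
      exact sub_eq_zero.1 (inner_self_eq_zero.1 (hK' _ hK))
    choose n hn using key
    refine ⟨n, fun j i => ?_, fun j => ?_⟩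
    · have h1 := hksum i fun i => (n j i : ℂ)
      rw [← hn j] at h1
      have h2 := norm_inner_le_norm (𝕜 := ℂ) (k i)
        ((memLp_pullback hΩ hφ hbij (hg j) (hgm j)).toLp _)
      rw [h1, norm_mul, Lp.norm_toLp, eLpNorm_pullback hΩ hφ hbij, ← Lp.norm_toLp _ (hgm j)] at h2
      rw [le_div_iff₀ (norm_pos_iff.2 (hκ i))]
      simpa using h2
    · refine Measure.eqOn_open_of_ae_eq (μ := volume) ?_ hΩ
        (differentiableOn_pullback hΩ hφ hbij.mapsTo (hg j)).continuousOn
        (DifferentiableOn.fun_sum fun i _ => (hg i).const_mul _).continuousOn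
      have h1 := (memLp_pullback hΩ hφ hbij (hg j) (hgm j)).coeFn_toLp
      rw [hn j] at h1
      exact h1.symm.trans (coeFn_sum_smul_toLp hgm _)

end

/-- The quotient of two independent holomorphic functions is injective somewhere. -/
lemma exists_isOpen_injOn_div {g₁ g₂ : ℂ → ℂ} {U : Set ℂ} (hU : IsOpen U) (hUc : IsPreconnected U)
    (h₁ : DifferentiableOn ℂ g₁ U) (h₂ : DifferentiableOn ℂ g₂ U)
    (hind : ∀ a b : ℂ, (∀ z ∈ U, a * g₁ z + b * g₂ z = 0) → a = 0 ∧ b = 0) :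
    ∃ V ⊆ U, IsOpen V ∧ V.Nonempty ∧ (∀ z ∈ V, g₂ z ≠ 0) ∧
      InjOn (fun z => g₁ z / g₂ z) V := by
  obtain ⟨z₀, hz₀, hg₀⟩ : ∃ z ∈ U, g₂ z ≠ 0 := by
    by_contra! h
    exact one_ne_zero (hind 0 1 fun z hz => by simp [h z hz]).2
  set W : Set ℂ := U ∩ g₂ ⁻¹' {0}ᶜ with hW
  have hWo : IsOpen W := h₂.continuousOn.isOpen_inter_preimage hU isOpen_compl_singleton
  have hQ : DifferentiableOn ℂ (fun z => g₁ z / g₂ z) W :=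
    (h₁.mono inter_subset_left).fun_div (h₂.mono inter_subset_left) fun z hz => hz.2
  by_cases hd : ∃ z ∈ W, deriv (fun z => g₁ z / g₂ z) z ≠ 0
  · obtain ⟨z, hz, hdz⟩ := hd
    have hs : HasStrictDerivAt (fun z => g₁ z / g₂ z) (deriv (fun z => g₁ z / g₂ z) z) z :=
      (hQ.analyticAt (hWo.mem_nhds hz)).hasStrictDerivAt
    have hs' := hs.hasStrictFDerivAt_equiv hdz
    refine ⟨W ∩ (hs'.toOpenPartialHomeomorph _).source, fun w hw => hw.1.1,
      hWo.inter (hs'.toOpenPartialHomeomorph _).open_source,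
      ⟨z, hz, hs'.mem_toOpenPartialHomeomorph_source⟩, fun w hw => hw.1.2, ?_⟩
    exact (hs'.toOpenPartialHomeomorph _).injOn.mono inter_subset_right
  · push Not at hd
    exfalso
    obtain ⟨δ, hδ, hδW⟩ := Metric.isOpen_iff.1 hWo z₀ ⟨hz₀, hg₀⟩
    set q := g₁ z₀ / g₂ z₀ with hq
    have hconst : ∀ z ∈ ball z₀ δ, g₁ z / g₂ z = q := fun z hz =>
      isOpen_ball.is_const_of_deriv_eq_zero (convex_ball z₀ δ).isPreconnected (hQ.mono hδW)
        (fun w hw => hd w (hδW hw)) hz (mem_ball_self hδ)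
    have hev : g₁ =ᶠ[𝓝 z₀] fun z => q * g₂ z := by
      filter_upwards [ball_mem_nhds z₀ hδ] with z hz
      rw [← hconst z hz, div_mul_cancel₀ _ (hδW hz).2]
    have heq := (h₁.analyticOnNhd hU).eqOn_of_preconnected_of_eventuallyEq
      ((h₂.const_mul q).analyticOnNhd hU) hUc hz₀ hev
    refine one_ne_zero (hind 1 (-q) fun z hz => ?_).1
    rw [heq hz]
    ring

/-- Only finitely many automorphisms pull back two given independent square integrable
holomorphic forms to prescribed ones. -/
lemma finite_automorphisms_of_pullback {g₁ g₂ : ℂ → ℂ} {U : Set ℂ} (hU : IsOpen U)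
    (hUc : IsPreconnected U) (h₁ : DifferentiableOn ℂ g₁ U) (h₂ : DifferentiableOn ℂ g₂ U)
    (hm : MemLp g₂ 2 (volume.restrict U))
    (hind : ∀ a b : ℂ, (∀ z ∈ U, a * g₁ z + b * g₂ z = 0) → a = 0 ∧ b = 0) (k₁ k₂ : ℂ → ℂ) :
    {f : U → ℂ | ∃ φ : ℂ → ℂ, (DifferentiableOn ℂ φ U ∧ BijOn φ U U ∧
      EqOn (pullback φ g₁) k₁ U ∧ EqOn (pullback φ g₂) k₂ U) ∧ ∀ z : U, f z = φ z}.Finite := by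
  obtain ⟨V, hVU, hV, hVne, hV0, hVinj⟩ := exists_isOpen_injOn_div hU hUc h₁ h₂ hind
  set S := {f : U → ℂ | ∃ φ : ℂ → ℂ, (DifferentiableOn ℂ φ U ∧ BijOn φ U U ∧
      EqOn (pullback φ g₁) k₁ U ∧ EqOn (pullback φ g₂) k₂ U) ∧ ∀ z : U, f z = φ z} with hS
  choose φ hφ hfφ using fun f : S => f.2
  have hT : ∀ f, IsOpen (U ∩ φ f ⁻¹' V) := fun f =>
    (hφ f).1.continuousOn.isOpen_inter_preimage hU hV
  have himg : ∀ f, φ f '' (U ∩ φ f ⁻¹' V) = V := by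
    intro f
    rw [image_inter_preimage, (hφ f).2.1.image_eq, inter_eq_right.2 hVU]
  have hlint : ∀ f, ∀ A ⊆ U, MeasurableSet A →
      ∫⁻ z in A, ‖k₂ z‖ₑ ^ 2 = ∫⁻ z in φ f '' A, ‖g₂ z‖ₑ ^ 2 := by
    intro f A hA hAm
    rw [← setLIntegral_pullback hU (hφ f).1 (hφ f).2.1.injOn hAm hA]
    exact setLIntegral_congr_fun hAm fun z hz => by
      simp only [← (hφ f).2.2.2 (hA hz), pullback]
  have hfin : ∫⁻ z in U, ‖g₂ z‖ₑ ^ 2 < ∞ := by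
    have := hm.2
    rw [eLpNorm_two_eq] at this
    by_contra h
    rw [not_lt, top_le_iff] at h
    rw [h] at this
    simp at this
  have hpos : ∫⁻ z in V, ‖g₂ z‖ₑ ^ 2 ≠ 0 := by
    intro h
    have hmeas : AEMeasurable (fun z => ‖g₂ z‖ₑ ^ 2) (volume.restrict V) :=
      ((h₂.continuousOn.mono hVU).aestronglyMeasurable hV.measurableSet).enorm.pow_const 2
    rw [lintegral_eq_zero_iff' hmeas] at h
    have h' : g₂ =ᵐ[volume.restrict V] fun _ => 0 := by
      filter_upwards [h] with z hz
      simpa using hz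
    obtain ⟨z, hz⟩ := hVne
    exact hV0 z hz (Measure.eqOn_open_of_ae_eq h' hV (h₂.continuousOn.mono hVU)
      continuousOn_const hz)
  have hdisj : Pairwise (Function.onFun Disjoint fun f => U ∩ φ f ⁻¹' V) := by
    intro f f' hne
    rw [Function.onFun, disjoint_left]
    rintro a ha ha'
    refine hne (Subtype.ext (funext fun z => ?_))
    rw [hfφ, hfφ]
    have hQ : ∀ F : S, ∀ z ∈ U, g₁ (φ F z) / g₂ (φ F z) = k₁ z / k₂ z := by
      intro F z hz
      rw [← (hφ F).2.2.1 hz, ← (hφ F).2.2.2 hz, pullback, pullback, mul_div_mul_right]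
      exact deriv_ne_zero_of_injOn hU (hφ F).1 (hφ F).2.1.injOn hz
    have hev : φ f =ᶠ[𝓝 a] φ f' := by
      filter_upwards [(hT f).mem_nhds ha, (hT f').mem_nhds ha'] with w hw hw'
      refine hVinj hw.2 hw'.2 ?_
      simp only
      rw [hQ f w hw.1, hQ f' w hw.1]
    exact ((hφ f).1.analyticOnNhd hU).eqOn_of_preconnected_of_eventuallyEq
      ((hφ f').1.analyticOnNhd hU) hUc ha.1 hev z.2
  rcases S.eq_empty_or_nonempty with hSe | ⟨f₀, hf₀⟩
  · rw [hSe]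
    exact finite_empty
  set ν := volume.withDensity fun z => ‖k₂ z‖ₑ ^ 2 with hν
  have hνU : ν (⋃ f, U ∩ φ f ⁻¹' V) ≠ ∞ := by
    refine ((measure_mono (iUnion_subset fun f => inter_subset_left)).trans_lt ?_).ne (b := ∞)
    rw [hν, withDensity_apply _ hU.measurableSet, hlint ⟨f₀, hf₀⟩ U subset_rfl hU.measurableSet,
      (hφ _).2.1.image_eq]
    exact hfin
  have hfinal := Measure.finite_const_le_meas_of_disjoint_iUnion ν (pos_iff_ne_zero.2 hpos)
    (fun f => (hT f).measurableSet) hdisj hνU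
  have huniv : {f | ∫⁻ z in V, ‖g₂ z‖ₑ ^ 2 ≤ ν (U ∩ φ f ⁻¹' V)} = univ := by
    refine eq_univ_of_forall fun f => ?_
    rw [mem_ofPred_eq, hν, withDensity_apply _ (hT f).measurableSet,
      hlint f _ inter_subset_left (hT f).measurableSet, himg]
  rw [huniv] at hfinal
  exact finite_coe_iff.1 (finite_univ_iff.1 hfinal)

end HoledDiscAut

/-- If `m ≥ 2` pairwise disjoint closed discs contained in the open unit disc are
removed from it, the resulting domain has finite automorphism group (stated as:
the set of restrictions to the domain of its automorphisms is finite). -/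
theorem finitely_many_automorphisms_of_holed_disc (m : ℕ) (hm : 2 ≤ m)
    (c : Fin m → ℂ) (r : Fin m → ℝ) (hr : ∀ i, 0 < r i)
    (hsub : ∀ i, Metric.closedBall (c i) (r i) ⊆ Metric.ball (0:ℂ) 1)
    (hdisj : ∀ i j, i ≠ j →
      Disjoint (Metric.closedBall (c i) (r i)) (Metric.closedBall (c j) (r j))) :
    Set.Finite {f : ↥(HoledDisc m c r) → ℂ |
      ∃ φ : ℂ → ℂ, DifferentiableOn ℂ φ (HoledDisc m c r) ∧
        Set.BijOn φ (HoledDisc m c r) (HoledDisc m c r) ∧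
        ∀ z : ↥(HoledDisc m c r), f z = φ ↑z} := by
  obtain ⟨g, N, hg, hgm, hind, hact⟩ := HoledDiscAut.exists_forms hr hsub hdisj
  let i₀ : Fin m := ⟨0, by omega⟩
  let i₁ : Fin m := ⟨1, by omega⟩
  have hne : i₀ ≠ i₁ := by simp [i₀, i₁]
  have hind' : ∀ a b : ℂ, (∀ z ∈ HoledDisc m c r, a * g i₀ z + b * g i₁ z = 0) →
      a = 0 ∧ b = 0 := by
    intro a b hab
    have h := hind (fun i => if i = i₀ then a else if i = i₁ then b else 0) fun z hz => by
      refine Eq.trans ?_ (hab z hz)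
      rw [Finset.sum_eq_add i₀ i₁ hne]
      · simp [hne.symm]
      · intro i _ hi
        simp [hi.1, hi.2]
      · simp
      · simp
    exact ⟨by simpa using h i₀, by simpa [hne.symm] using h i₁⟩
  have hfin : {n : Fin m → Fin m → ℤ | ∀ j i, |(n j i : ℝ)| ≤ N j i}.Finite := by
    refine (Set.finite_Icc (fun j i => -⌈N j i⌉) (fun j i => ⌈N j i⌉)).subset fun n hn => ?_
    have h : ∀ j i, |n j i| ≤ ⌈N j i⌉ := fun j i => by
      have h1 := (hn j i).trans (Int.le_ceil _)
      exact_mod_cast h1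
    exact ⟨fun j i => (abs_le.1 (h j i)).1, fun j i => (abs_le.1 (h j i)).2⟩
  refine (hfin.biUnion fun n _ => HoledDiscAut.finite_automorphisms_of_pullback
    (HoledDiscAut.isOpen_holedDisc m c r)
    (HoledDiscAut.isPreconnected_holedDisc hr hsub hdisj) (hg i₀) (hg i₁) (hgm i₁) hind'
    (fun z => ∑ i, (n i₀ i : ℂ) * g i z) (fun z => ∑ i, (n i₁ i : ℂ) * g i z)).subset ?_
  rintro f ⟨φ, hφ, hbij, hf⟩
  obtain ⟨n, hn, hpull⟩ := hact φ hφ hbij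
  exact Set.mem_biUnion (show n ∈ {n : Fin m → Fin m → ℤ | ∀ j i, |(n j i : ℝ)| ≤ N j i} from hn)
    ⟨φ, ⟨hφ, hbij, hpull i₀, hpull i₁⟩, hf⟩
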